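/- arXiv:1701.01493 — 2 statements merged into one kernel-verified Lean document; each statement's English description precedes it below -/
import Mathlib

section
/- For every u ∈ I_{g+1} (so K_u is ramified imaginary of genus g) and every s ∈ ℂ with Re(s) ≥ 1/2, L(s,χ_u) = Σ_{n=0}^{g} A_u(n) q^{−sn} + q^{(1−2s)g} Σ_{n=0}^{g−1} A_u(n) q^{(s−1)n}. -/
open Polynomial UniqueFactorizationMonoid

noncomputable section

namespace EvenChar

variable {Fq : Type} [Field Fq] [Fintype Fq]

/-- Solvability of the congruence `X² + X ≡ u (mod P)` in `Fq[T]`. -/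
def hasseSolvable (u : RatFunc Fq) (P : Polynomial Fq) : Prop :=
  ∃ x : Polynomial Fq, P ∣ ((x ^ 2 + x) * u.denom - u.num)

open scoped Classical in
/-- The quadratic symbol `{u/f}` for a monic polynomial `f`. -/
def quadSym (u : RatFunc Fq) (f : Polynomial Fq) : ℤ :=
  if IsCoprime f u.denom then
    ((normalizedFactors f).map fun P => if hasseSolvable u P then (1 : ℤ) else -1).prod
  else 0

variable (Fq) in
/-- The family `F_n` of real quadratic `u`'s. -/
def Ffam (n : ℕ) : Set (RatFunc Fq) :=
  { u | ∃ (S : Finset (Polynomial Fq)) (e : Polynomial Fq → ℕ)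
        (a : Polynomial Fq → ℕ → Polynomial Fq),
      (∀ P ∈ S, P.Monic ∧ Irreducible P) ∧
      (∀ P ∈ S, 1 ≤ e P) ∧
      (∀ P ∈ S, ∀ i, 1 ≤ i → i ≤ e P → (a P i).degree < P.degree) ∧
      (∀ P ∈ S, a P (e P) ≠ 0) ∧
      (∑ P ∈ S, e P * P.natDegree) = n ∧
      u = ∑ P ∈ S, ∑ i ∈ Finset.Icc 1 (e P),
            algebraMap (Polynomial Fq) (RatFunc Fq) (a P i) /
              algebraMap (Polynomial Fq) (RatFunc Fq) P ^ (2 * i - 1) }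

/-- The family `G_s` of odd polynomial parts. -/
def Gfam (ξ : Fq) (s : ℕ) : Set (Polynomial Fq) :=
  { G | ∃ (α : Fq) (c : ℕ → Fq), (α = 0 ∨ α = ξ) ∧ c s ≠ 0 ∧
      G = C α + ∑ i ∈ Finset.Icc 1 s, C (c i) * X ^ (2 * i - 1) }

/-- The family `I_{(r,s)}`. -/
def Irs (ξ : Fq) (r s : ℕ) : Set (RatFunc Fq) :=
  { u | ∃ v ∈ Ffam Fq r, ∃ G ∈ Gfam ξ s,
      u = v + algebraMap (Polynomial Fq) (RatFunc Fq) G }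

/-- The family `I_n` of ramified imaginary `u`'s. -/
def Ifam (ξ : Fq) (n : ℕ) : Set (RatFunc Fq) :=
  ⋃ (r : ℕ) (s : ℕ) (_ : 1 ≤ s) (_ : r + s = n), Irs ξ r s

/-- The family `F'_n` of inert imaginary `u`'s. -/
def F'fam (ξ : Fq) (n : ℕ) : Set (RatFunc Fq) :=
  (fun u => u + RatFunc.C ξ) '' Ffam Fq n

/-- `A_u(n) = ∑_{f monic, deg f = n} χ_u(f)`. -/
def Acoeff (u : RatFunc Fq) (n : ℕ) : ℂ :=
  ∑' f : {f : Polynomial Fq // f.Monic ∧ f.natDegree = n}, (quadSym u f.1 : ℂ)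

/-- `L(s, χ_u)` as the polynomial `∑_{n=0}^{N} A_u(n) q^{-sn}` in `q^{-s}`. -/
def Lfun (N : ℕ) (u : RatFunc Fq) (s : ℂ) : ℂ :=
  ∑ n ∈ Finset.range (N + 1), Acoeff u n * (Fintype.card Fq : ℂ) ^ (-(s * (n : ℂ)))

/-- `ζ_A(s) = (1 - q^{1-s})⁻¹`. -/
def zetaC (q : ℕ) (s : ℂ) : ℂ := (1 - (q : ℂ) ^ ((1 : ℂ) - s))⁻¹

variable (Fq) in
/-- The Euler product `P(s) = ∏_P (1 - 1/(|P|^s (|P|+1)))`. -/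
def eulerP (s : ℂ) : ℂ :=
  ∏' P : {P : Polynomial Fq // P.Monic ∧ Irreducible P},
    (1 - (((Fintype.card Fq : ℂ) ^ (P.1.natDegree : ℂ)) ^ s *
          ((Fintype.card Fq : ℂ) ^ (P.1.natDegree : ℂ) + 1))⁻¹)

variable (Fq) in
/-- `(1/log q)·(P'/P)(1) = ∑_P deg P / (|P|(|P|+1) - 1)`. -/
def eulerPlogDeriv : ℂ :=
  ∑' P : {P : Polynomial Fq // P.Monic ∧ Irreducible P},
    (P.1.natDegree : ℂ) /
      ((Fintype.card Fq : ℂ) ^ (P.1.natDegree : ℂ) *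
        ((Fintype.card Fq : ℂ) ^ (P.1.natDegree : ℂ) + 1) - 1)

end EvenChar

namespace EvenChar

section Residues

variable {K : Type} [Field K]

/-- The sum of the residues at the finite places of `A / B` for monic `B`, i.e. the coefficient of
`1/T` in the expansion of `A / B` at infinity. -/
def res (B : K[X]) : K[X] →ₗ[K] K :=
  (Polynomial.lcoeff K (B.natDegree - 1)).comp (Polynomial.modByMonicHom B)

lemma res_apply (B A : K[X]) : res B A = (A %ₘ B).coeff (B.natDegree - 1) := rfl

lemma res_congr {B A A' : K[X]} (hB : B.Monic) (h : B ∣ A - A') : res B A = res B A' := by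
  rw [res_apply, res_apply, modByMonic_eq_of_dvd_sub hB h]

lemma res_dvd {B A : K[X]} (hB : B.Monic) (h : B ∣ A) : res B A = 0 := by
  rw [res_apply, (modByMonic_eq_zero_iff_dvd hB).2 h, coeff_zero]

lemma res_of_degree_lt {B A : K[X]} (hB : B.Monic)
    (h : A.degree < ((B.natDegree - 1 : ℕ) : WithBot ℕ)) : res B A = 0 := by
  rw [res_apply, (modByMonic_eq_self_iff hB).2]
  · exact coeff_eq_zero_of_degree_lt h
  · rw [degree_eq_natDegree hB.ne_zero]
    exact h.trans_le (by exact_mod_cast Nat.sub_le _ _)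

lemma mul_mod_mul {B A D : K[X]} (hB : B.Monic) (hD : D.Monic) :
    (A * D) %ₘ (B * D) = (A %ₘ B) * D := by
  refine (div_modByMonic_unique (A /ₘ B) ((A %ₘ B) * D) (hB.mul hD) ⟨?_, ?_⟩).2
  · have := modByMonic_add_div A B
    linear_combination D * this
  · rw [degree_mul, degree_mul]
    have h1 : (A %ₘ B).degree < B.degree := degree_modByMonic_lt _ hB
    rw [degree_eq_natDegree hD.ne_zero]
    exact WithBot.add_lt_add_right (by simp) h1

lemma res_mul_right {B D : K[X]} (hB : B.Monic) (hD : D.Monic) (A : K[X]) :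
    res (B * D) (A * D) = res B A := by
  rw [res_apply, res_apply, mul_mod_mul hB hD, hB.natDegree_mul hD]
  by_cases h0 : B.natDegree = 0
  · have : B = 1 := hB.natDegree_eq_zero.1 h0
    subst this
    simp
  · have h1 : (A %ₘ B).natDegree ≤ B.natDegree - 1 := by
      have := natDegree_modByMonic_lt A hB (by rintro rfl; simp at h0)
      omega
    rw [show B.natDegree + D.natDegree - 1 = (B.natDegree - 1) + D.natDegree by omega,
      coeff_mul_add_eq_of_natDegree_le h1 le_rfl]
    simp [hD.coeff_natDegree]

lemma res_mul_left {B D : K[X]} (hB : B.Monic) (hD : D.Monic) (A : K[X]) :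
    res (D * B) (D * A) = res B A := by
  rw [mul_comm D, mul_comm D, res_mul_right hB hD]

lemma natDegree_derivative_mul_le (A B : K[X]) (n : ℕ) (hA : A.degree < (n : WithBot ℕ)) (hB : B.natDegree ≤ n) :
    (derivative A * B - A * derivative B).degree < ((2 * n - 1 : ℕ) : WithBot ℕ) := by
  by_cases h0 : A = 0
  · subst h0; simp
  have hA' : A.natDegree < n := (natDegree_lt_iff_degree_lt h0).2 hA
  refine (degree_sub_le _ _).trans_lt (max_lt ?_ ?_)
  · by_cases hd : derivative A * B = 0
    · rw [hd]; simp
    rw [← natDegree_lt_iff_degree_lt hd]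
    have hd1 := left_ne_zero_of_mul hd
    have : A.natDegree ≠ 0 := fun h => hd1 (derivative_of_natDegree_zero h)
    have h1 := natDegree_derivative_lt this
    have h2 := natDegree_mul_le (p := derivative A) (q := B)
    omega
  · by_cases hd : A * derivative B = 0
    · rw [hd]; simp
    rw [← natDegree_lt_iff_degree_lt hd]
    have hd1 := right_ne_zero_of_mul hd
    have : B.natDegree ≠ 0 := fun h => hd1 (derivative_of_natDegree_zero h)
    have h1 := natDegree_derivative_lt this
    have h2 := natDegree_mul_le (p := A) (q := derivative B)
    omega

/-- The residue of a derivative vanishes. -/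
lemma res_derivative {B : K[X]} (hB : B.Monic) (A : K[X]) :
    res (B * B) (derivative A * B - A * derivative B) = 0 := by
  have h := modByMonic_add_div A B
  rw [res_congr (A' := derivative (A %ₘ B) * B - (A %ₘ B) * derivative B) (hB.mul hB)]
  · refine res_of_degree_lt (hB.mul hB) ?_
    rw [hB.natDegree_mul hB, ← two_mul]
    refine natDegree_derivative_mul_le _ _ _ ?_ le_rfl
    rw [← degree_eq_natDegree hB.ne_zero]
    exact degree_modByMonic_lt _ hB
  · refine ⟨derivative (A /ₘ B), ?_⟩
    nth_rewrite 1 [← h]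
    nth_rewrite 3 [← h]
    simp only [derivative_add, derivative_mul]
    ring

lemma res_split {M f κ μ : K[X]} (hM : M.Monic) (hf : f.Monic) (h : κ * M + μ * f = 1) (A : K[X]) :
    res (M * f) A = res f (κ * A) + res M (μ * A) := by
  have : A = M * (κ * A) + (μ * A) * f := by linear_combination (-A) * h
  nth_rewrite 1 [this]
  rw [map_add, res_mul_left hf hM, res_mul_right hM hf]

variable [CharP K 2]

lemma derivative_sq' (A : K[X]) : derivative (A ^ 2) = 0 := by
  rw [derivative_pow]
  have : (2 : K) = 0 := CharP.cast_eq_zero K 2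
  simp [this]

lemma two_eq_zero' : (2 : K[X]) = 0 := by
  have := CharP.cast_eq_zero K[X] 2
  exact_mod_cast this

lemma res_infty {N E f x b : K[X]} {n d : ℕ} (hN : N.Monic) (hf : f.Monic) (hf2 : (f + N * x).Monic)
    (hn : f.natDegree = n) (hn2 : (f + N * x).natDegree = n)
    (hE : derivative E = b ^ 2) (hdE : E.natDegree + 1 ≤ 2 * d + 2 * N.natDegree)
    (hx : (N * x).degree < (n - d + 1 : ℕ)) (hdn : d ≤ n) (hd : 1 ≤ d) :
    res (N ^ 2 * (f + N * x)) (E * derivative (f + N * x)) + res (N ^ 2 * f) (E * derivative f) =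
      res (N * f) (b ^ 2 * x) := by
  have h2 : (2 : K[X]) = 0 := two_eq_zero'
  have hN2 : (N ^ 2).Monic := hN.pow 2
  set y := N * x with hy
  set w := derivative y * f - y * derivative f with hw
  rw [← res_mul_right (hN2.mul hf2) hf, ← res_mul_right (hN2.mul hf) hf2,
    show N ^ 2 * f * (f + y) = N ^ 2 * (f + y) * f by ring, ← map_add,
    show E * derivative (f + y) * f + E * derivative f * (f + y) = E * w by
      rw [hw, derivative_add]
      linear_combination (E * derivative f * f + E * derivative f * y) * h2,
    ← res_mul_right ((hN2.mul hf2).mul hf) hf,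
    show E * w * f = E * w * (f + y) + E * w * y by
      linear_combination (- E * w * y) * h2, map_add,
    show N ^ 2 * (f + y) * f * f = N ^ 2 * (f * f) * (f + y) by ring,
    res_mul_right (hN2.mul (hf.mul hf)) hf2]
  have z1 : res (N ^ 2 * (f * f) * (f + y)) (E * w * y) = 0 := by
    refine res_of_degree_lt ((hN2.mul (hf.mul hf)).mul hf2) ?_
    rw [(hN2.mul (hf.mul hf)).natDegree_mul hf2, hN2.natDegree_mul (hf.mul hf), hf.natDegree_mul hf,
      hN.natDegree_pow, hn2, hn]
    by_cases h0 : E * w * y = 0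
    · rw [h0]; simp
    have hy0 : y ≠ 0 := right_ne_zero_of_mul h0
    have hw0 : w ≠ 0 := right_ne_zero_of_mul (left_ne_zero_of_mul h0)
    rw [← natDegree_lt_iff_degree_lt h0]
    have e1 := natDegree_mul_le (p := E * w) (q := y)
    have e2 := natDegree_mul_le (p := E) (q := w)
    have e3 := (natDegree_lt_iff_degree_lt hy0).2 hx
    have e4 : w.natDegree + 1 ≤ n + y.natDegree := by
      by_cases hn0 : n = 0
      · exfalso; omega
      · have : w.natDegree ≤ n + y.natDegree - 1 := by
          refine (natDegree_sub_le _ _).trans (max_le ?_ ?_)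
          · by_cases hd : y.natDegree = 0
            · rw [derivative_of_natDegree_zero hd]; simp
            have := natDegree_derivative_lt hd
            have := natDegree_mul_le (p := derivative y) (q := f)
            omega
          · have := natDegree_derivative_lt (p := f) (by omega)
            have := natDegree_mul_le (p := y) (q := derivative f)
            omega
        omega
    omega
  have z2 : res (N ^ 2 * (f * f)) (E * w) + res (N * f) (b ^ 2 * x) = 0 := by
    have := res_derivative (hN2.mul hf) (E * y)
    rw [← this, ← res_mul_right (hN2.mul (hf.mul hf)) hN2,
      ← res_mul_right (hN.mul hf) (hN.mul (hN2.mul hf)),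
      show N * f * (N * (N ^ 2 * f)) = N ^ 2 * f * (N ^ 2 * f) by ring,
      show N ^ 2 * (f * f) * N ^ 2 = N ^ 2 * f * (N ^ 2 * f) by ring, ← map_add]
    congr 1
    simp only [derivative_mul, derivative_sq', hE, hw, hy]
    ring
  rw [z1, add_zero]
  have : (2 : K) = 0 := CharP.cast_eq_zero K 2
  linear_combination z2 - res (N * f) (b ^ 2 * x) * this

lemma congr_aux {R : Type*} [CommRing R] {N N' E f f' x x' μ μ' dμ : R} (h2 : (2 : R) = 0)
    (h1 : μ * f = 1) (h1' : μ' * (f + N * x) = 1) (hN : N ^ 2 = 0) (hE : E * N' * N = 0)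
    (hd : dμ * f + μ * f' = 0) :
    μ' * (E * (f' + (N' * x + N * x'))) + μ * (E * f') =
      E * (dμ * (N * x) + μ * (N' * x + N * x')) := by
  have e1 : μ' = μ - μ' * μ * (N * x) := by linear_combination μ * h1' - μ' * h1
  have e2 : μ' * N = μ * N := by linear_combination N * e1 - μ' * μ * x * hN
  have e3 : μ' = μ - μ ^ 2 * N * x := by linear_combination e1 - μ * x * e2
  have e4 : dμ = - μ ^ 2 * f' := by linear_combination μ * hd - dμ * h1
  rw [e3, e4]
  linear_combination (μ * E * f') * h2 - E * μ ^ 2 * x * x' * hN - μ ^ 2 * x ^ 2 * hE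

lemma res_finite {N E f x b μ μ' : K[X]} (hN : N.Monic)
    (hE : derivative E = b ^ 2) (hEN : N ∣ E * derivative N)
    (hμ : N ^ 2 ∣ μ * f - 1) (hμ' : N ^ 2 ∣ μ' * (f + N * x) - 1) :
    res (N ^ 2) (μ' * (E * derivative (f + N * x))) + res (N ^ 2) (μ * (E * derivative f)) =
      res N (μ * (b ^ 2 * x)) := by
  have h2 : (2 : K[X]) = 0 := two_eq_zero'
  have h2' : (2 : K) = 0 := CharP.cast_eq_zero K 2
  have hN2 : (N ^ 2).Monic := hN.pow 2
  have hder : res (N ^ 2) (E * derivative (μ * (N * x))) + res N (μ * (b ^ 2 * x)) = 0 := by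
    have := res_derivative hN2 (E * (μ * (N * x)))
    rw [derivative_sq', mul_zero, sub_zero, res_mul_right hN2 hN2] at this
    rw [← this, ← res_mul_right hN hN, ← sq, ← map_add]
    congr 1
    rw [derivative_mul (f := E), hE]; ring
  rw [← map_add]
  have key : res (N ^ 2) (μ' * (E * derivative (f + N * x)) + μ * (E * derivative f)) =
      res (N ^ 2) (E * derivative (μ * (N * x))) := by
    refine res_congr hN2 ?_
    rw [← Ideal.mem_span_singleton] at hμ hμ' ⊢
    have hNN : N ^ 2 ∈ Ideal.span {N ^ 2} := Ideal.mem_span_singleton_self _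
    have hEN' : E * derivative N * N ∈ Ideal.span {N ^ 2} := by
      rw [Ideal.mem_span_singleton, sq]
      exact mul_dvd_mul_right hEN _
    obtain ⟨k, hk⟩ := Ideal.mem_span_singleton.1 hμ
    have dk : derivative μ * f + μ * derivative f ∈ Ideal.span {N ^ 2} := by
      rw [Ideal.mem_span_singleton]
      have := congrArg derivative hk
      refine ⟨derivative k, ?_⟩
      simpa [derivative_mul, derivative_sq'] using this
    rw [← Ideal.Quotient.mk_eq_mk_iff_sub_mem] at hμ hμ' ⊢
    rw [← Ideal.Quotient.eq_zero_iff_mem] at hNN hEN' dk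
    rw [derivative_add, derivative_mul (f := μ), derivative_mul (f := N)]
    simp only [map_add, map_mul, map_pow, map_one] at *
    have h2q := congrArg (Ideal.Quotient.mk (Ideal.span {N ^ 2})) h2
    simp only [map_ofNat, map_zero] at h2q
    exact congr_aux h2q hμ hμ' hNN hEN' dk
  rw [key]
  linear_combination hder - res N (μ * (b ^ 2 * x)) * h2'

end Residues

section Variation

variable {K : Type} [Field K] [CharP K 2]

/-- How the "logarithmic" sum attached to `f` changes when `f` is moved in the class mod `N`. -/
lemma variation {N E f x b κ μ κ' μ' : K[X]} {n d : ℕ} (hN : N.Monic) (hf : f.Monic)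
    (hf2 : (f + N * x).Monic)
    (hn : f.natDegree = n) (hn2 : (f + N * x).natDegree = n)
    (hE : derivative E = b ^ 2) (hdE : E.natDegree + 1 ≤ 2 * d + 2 * N.natDegree)
    (hEN : N ∣ E * derivative N)
    (hx : (N * x).degree < (n - d + 1 : ℕ)) (hdn : d ≤ n) (hd : 1 ≤ d)
    (h : κ * N ^ 2 + μ * f = 1) (h' : κ' * N ^ 2 + μ' * (f + N * x) = 1) :
    res (f + N * x) (κ' * (E * derivative (f + N * x))) =
      res f (κ * (E * derivative f)) + res f (κ * N * (b ^ 2 * x)) := by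
  have h2' : (2 : K) = 0 := CharP.cast_eq_zero K 2
  have hN2 : (N ^ 2).Monic := hN.pow 2
  have s1 := res_split hN2 hf h (E * derivative f)
  have s2 := res_split hN2 hf2 h' (E * derivative (f + N * x))
  have s3 := res_split (κ := κ * N) (μ := μ) hN hf (by linear_combination h) (b ^ 2 * x)
  have i1 := res_infty hN hf hf2 hn hn2 hE hdE hx hdn hd
  have i2 := res_finite (μ := μ) (μ' := μ') (f := f) (x := x) hN hE hEN
    ⟨-κ, by linear_combination h⟩ ⟨-κ', by linear_combination h'⟩
  linear_combination i1 - s1 - s2 + s3 - i2 - res f (κ * (E * derivative f)) * h2'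

end Variation

section Trace

lemma artin_schreier {L : Type*} [Field L] [Finite L] [Algebra (ZMod 2) L] (z : L) :
    (∃ x : L, x ^ 2 + x = z) ↔ Algebra.trace (ZMod 2) L z = 0 := by
  classical
  have : CharP L 2 := charP_of_injective_algebraMap (algebraMap (ZMod 2) L).injective 2
  let φ : L →ₐ[ZMod 2] L := FiniteField.frobeniusAlgHom (ZMod 2) L
  have hφ : ∀ x, φ x = x ^ 2 := fun x => by simp [φ]
  let p : L →ₗ[ZMod 2] L := φ.toLinearMap + LinearMap.id
  have hp : ∀ x, p x = x ^ 2 + x := fun x => by simp [p, hφ]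
  have htr : ∀ x : L, Algebra.trace (ZMod 2) L (x ^ 2) = Algebra.trace (ZMod 2) L x := by
    intro x
    have := Algebra.trace_eq_of_algEquiv (FiniteField.frobeniusAlgEquivOfAlgebraic (ZMod 2) L) x
    simpa using this
  have hker : LinearMap.ker p = Submodule.span (ZMod 2) {(1 : L)} := by
    ext x
    rw [LinearMap.mem_ker, hp, Submodule.mem_span_singleton]
    constructor
    · intro h
      have : x * (x + 1) = 0 := by linear_combination h
      rcases mul_eq_zero.1 this with h | h
      · exact ⟨0, by simp [h]⟩
      · exact ⟨1, by rw [one_smul]; linear_combination -h + CharTwo.two_eq_zero (R := L)⟩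
    · rintro ⟨a, rfl⟩
      have ha : a = 0 ∨ a = 1 := by revert a; decide
      rcases ha with rfl | rfl
      · simp
      · simp [CharTwo.add_self_eq_zero]
  have hle : LinearMap.range p ≤ LinearMap.ker (Algebra.trace (ZMod 2) L) := by
    rintro _ ⟨x, rfl⟩
    rw [LinearMap.mem_ker, hp, map_add, htr, CharTwo.add_self_eq_zero]
  have hk1 : Module.finrank (ZMod 2) (LinearMap.ker p) = 1 := by
    rw [hker]; exact finrank_span_singleton one_ne_zero
  have h1 := LinearMap.finrank_range_add_finrank_ker p
  have h2 := LinearMap.finrank_range_add_finrank_ker (Algebra.trace (ZMod 2) L)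
  rw [LinearMap.range_eq_top.2 (Algebra.trace_surjective (ZMod 2) L), finrank_top,
    Module.finrank_self] at h2
  have heq := Submodule.eq_of_le_of_finrank_eq hle (by omega)
  rw [← LinearMap.mem_ker, ← heq, LinearMap.mem_range]
  simp [hp]

variable {K : Type} [Field K] [Finite K]

lemma trace_eq_res {P : K[X]} (hP : P.Monic) (hi : Irreducible P) (z : K[X]) :
    Algebra.trace K (AdjoinRoot P) (AdjoinRoot.mk P z) = res P (z * derivative P) := by
  classical
  have : Fact (Irreducible P) := ⟨hi⟩
  set pb := AdjoinRoot.powerBasis hP.ne_zero with hpb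
  have : FiniteDimensional K (AdjoinRoot P) := pb.finite
  have hmin : minpoly K pb.gen = P := AdjoinRoot.minpoly_powerBasis_gen_of_monic hP
  have hgen : pb.gen = AdjoinRoot.root P := AdjoinRoot.powerBasis_gen _
  have hd0 : P.natDegree ≠ 0 := hi.natDegree_pos.ne'
  have hdim : pb.dim = P.natDegree := AdjoinRoot.powerBasis_dim _
  have hgenInt : IsIntegral K pb.gen := Algebra.IsIntegral.isIntegral _
  have hmd := natDegree_minpolyDiv_succ hgenInt
  rw [hmin] at hmd
  set D := aeval pb.gen (derivative P) with hD
  have hDmk : D = AdjoinRoot.mk P (derivative P) := by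
    rw [hD, hgen, AdjoinRoot.aeval_eq]
  have hD0 : D ≠ 0 := by
    have : IsSeparable K pb.gen := Algebra.IsSeparable.isSeparable _ _
    have := Polynomial.Separable.aeval_derivative_ne_zero this
      (minpoly.aeval K pb.gen)
    rwa [hmin] at this
  have hb : ∀ j < P.natDegree, Algebra.trace K (AdjoinRoot P) (AdjoinRoot.mk P (X ^ j) / D) =
      if j = P.natDegree - 1 then 1 else 0 := by
    intro j hj
    have h1 := Module.Basis.traceDual_powerBasis_eq pb ⟨P.natDegree - 1, by omega⟩
    have h2 := (pb.basis.traceDual_eq_iff).1 rfl ⟨P.natDegree - 1, by omega⟩ ⟨j, by omega⟩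
    rw [h1, hmin, ← hD] at h2
    have h3 : (minpolyDiv K pb.gen).coeff (P.natDegree - 1) = 1 := by
      rw [← hmd, Nat.add_sub_cancel]
      exact (minpolyDiv_monic hgenInt).coeff_natDegree
    simp only [h3] at h2
    simp only [Algebra.traceForm_apply, PowerBasis.coe_basis, Fin.mk.injEq, hgen] at h2
    rw [← h2, map_pow, AdjoinRoot.mk_X]
    congr 1
    ring
  have key : AdjoinRoot.mk P z =
      ∑ j ∈ Finset.range P.natDegree, ((z * derivative P) %ₘ P).coeff j • (AdjoinRoot.mk P (X ^ j) / D) := by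
    have h1 : AdjoinRoot.mk P (z * derivative P) = AdjoinRoot.mk P ((z * derivative P) %ₘ P) := by
      rw [AdjoinRoot.mk_eq_mk]
      refine ⟨(z * derivative P) /ₘ P, ?_⟩
      have := modByMonic_add_div (z * derivative P) P
      linear_combination -this
    have h2 : (z * derivative P) %ₘ P = ∑ j ∈ Finset.range P.natDegree,
        ((z * derivative P) %ₘ P).coeff j • (X ^ j : K[X]) := by
      have hlt : ((z * derivative P) %ₘ P).natDegree < P.natDegree :=
        natDegree_modByMonic_lt _ hP (by rintro rfl; simp at hd0)
      conv_lhs => rw [as_sum_range' _ _ hlt]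
      simp [smul_eq_C_mul, C_mul_X_pow_eq_monomial]
    have h3 : AdjoinRoot.mk P z * D = ∑ j ∈ Finset.range P.natDegree,
        ((z * derivative P) %ₘ P).coeff j • (AdjoinRoot.mk P (X ^ j)) := by
      rw [hDmk, ← map_mul, h1]
      conv_lhs => rw [h2]
      rw [map_sum]
      refine Finset.sum_congr rfl fun j _ => ?_
      rw [AdjoinRoot.smul_mk]
    rw [eq_div_of_mul_eq hD0 h3, Finset.sum_div]
    refine Finset.sum_congr rfl fun j _ => ?_
    rw [smul_div_assoc]
  rw [key, map_sum, res_apply]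
  rw [Finset.sum_eq_single (P.natDegree - 1)]
  · rw [map_smul, hb _ (by omega)]; simp
  · intro j hj hne
    rw [map_smul, hb _ (Finset.mem_range.1 hj), if_neg hne, smul_zero]
  · intro h; exact absurd (Finset.mem_range.2 (by omega)) h

end Trace

section Symbol

variable {K : Type} [Field K]

/-- The arithmetic data extracted from a `u` in the family `I_{g+1}`. -/
structure IData (u : RatFunc K) (N E b : K[X]) (g : ℕ) : Prop where
  monic : N.Monic
  eq : u * algebraMap K[X] (RatFunc K) N ^ 2 = algebraMap K[X] (RatFunc K) E
  deriv : derivative E = b ^ 2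
  dvd : N ∣ E * derivative N
  cop : IsCoprime b N
  b_ne : b ≠ 0
  b_deg : b.natDegree = g
  N_deg : N.natDegree ≤ g
  E_deg : E.natDegree ≤ 2 * g + 1

lemma IData.num_denom {u : RatFunc K} {N E b : K[X]} {g : ℕ} (h : IData u N E b g) :
    u.num * N ^ 2 = E * u.denom := by
  apply IsFractionRing.injective K[X] (RatFunc K)
  have h1 := RatFunc.num_div_denom u
  have h2 : algebraMap K[X] (RatFunc K) u.denom ≠ 0 := by
    simpa using RatFunc.denom_ne_zero u
  rw [map_mul, map_mul, map_pow, ← h.eq]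
  rw [div_eq_iff h2] at h1
  rw [h1]; ring

lemma IData.dvd_denom [CharP K 2] {u : RatFunc K} {N E b : K[X]} {g : ℕ} (h : IData u N E b g) {P : K[X]}
    (hP : Irreducible P) (hPN : P ∣ N) : P ∣ u.denom := by
  by_contra hd
  have h1 : P ^ 2 ∣ E * u.denom := by
    rw [← h.num_denom]
    exact Dvd.dvd.mul_left (pow_dvd_pow_of_dvd hPN 2) _
  have h2 : IsCoprime (P ^ 2) u.denom := ((hP.coprime_iff_not_dvd).2 hd).pow_left
  obtain ⟨F, hF⟩ := h2.dvd_of_dvd_mul_right h1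
  have h3 : derivative E = P ^ 2 * derivative F := by
    rw [hF, derivative_mul, derivative_sq', zero_mul, zero_add]
  rw [h.deriv] at h3
  have h4 : P ∣ b := hP.prime.dvd_of_dvd_pow (n := 2)
    (by rw [h3]; exact Dvd.dvd.mul_right (dvd_pow_self _ two_ne_zero) _)
  exact hP.not_isUnit (h.cop.isUnit_of_dvd' h4 hPN)

lemma IData.coprime_iff [CharP K 2] {u : RatFunc K} {N E b : K[X]} {g : ℕ} (h : IData u N E b g) (f : K[X]) :
    IsCoprime f u.denom ↔ IsCoprime f N := by
  constructor
  · intro hc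
    refine isCoprime_of_prime_dvd ?_ ?_
    · rintro ⟨-, h0⟩
      exact h.monic.ne_zero h0
    · intro P hP hPf hPN
      exact hP.not_isUnit (hc.isUnit_of_dvd' hPf (h.dvd_denom hP.irreducible hPN))
  · intro hc
    have h1 : u.denom ∣ N ^ 2 := by
      have : u.denom ∣ u.num * N ^ 2 := ⟨E, by rw [h.num_denom]; ring⟩
      exact (RatFunc.isCoprime_num_denom u).symm.dvd_of_dvd_mul_left this
    exact (hc.pow_right (n := 2)).of_isCoprime_of_dvd_right h1

/-- The quadratic additive character of a finite field of characteristic two. -/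
def psi [Algebra (ZMod 2) K] (t : K) : ℤ := if Algebra.trace (ZMod 2) K t = 0 then 1 else -1

lemma psi_zero [Algebra (ZMod 2) K] : psi (0 : K) = 1 := by simp [psi]

lemma psi_add [Algebra (ZMod 2) K] (s t : K) : psi (s + t) = psi s * psi t := by
  unfold psi
  rw [map_add]
  generalize Algebra.trace (ZMod 2) K s = a
  generalize Algebra.trace (ZMod 2) K t = b
  revert a b
  decide

lemma psi_multiset_sum [Algebra (ZMod 2) K] {ι : Type*} (s : Multiset ι) (F : ι → K) :
    psi (s.map F).sum = (s.map fun i => psi (F i)).prod := by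
  induction s using Multiset.induction_on with
  | empty => simp [psi_zero]
  | cons a s ih => simp [psi_add, ih]

lemma res_log_sum (z : K[X]) (s : Multiset K[X]) (hs : ∀ P ∈ s, P.Monic) :
    res s.prod (z * derivative s.prod) = (s.map fun P => res P (z * derivative P)).sum := by
  induction s using Multiset.induction_on with
  | empty => simp
  | cons a s ih =>
    have ha : a.Monic := hs a (by simp)
    have hs' : ∀ P ∈ s, P.Monic := fun P hP => hs P (by simp [hP])
    have hm : s.prod.Monic := by
      have := monic_multiset_prod_of_monic s id hs'
      rwa [Multiset.map_id] at this
    rw [Multiset.prod_cons, Multiset.map_cons, Multiset.sum_cons, ← ih hs', derivative_mul,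
      show z * (derivative a * s.prod + a * derivative s.prod) =
        (z * derivative a) * s.prod + a * (z * derivative s.prod) by ring, map_add,
      res_mul_right ha hm, res_mul_left hm ha]

lemma quadSym_mul (u : RatFunc K) {f h : K[X]} (hf : f ≠ 0) (hh : h ≠ 0) :
    quadSym u (f * h) = quadSym u f * quadSym u h := by
  classical
  unfold quadSym
  by_cases h1 : IsCoprime f u.denom
  · by_cases h2 : IsCoprime h u.denom
    · rw [if_pos h1, if_pos h2, if_pos (h1.mul_left h2), normalizedFactors_mul hf hh,
        Multiset.map_add, Multiset.prod_add]
    · rw [if_neg h2, if_neg fun h' => h2 (IsCoprime.of_mul_left_right h'), mul_zero]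
  · rw [if_neg h1, if_neg fun h' => h1 (IsCoprime.of_mul_left_left h'), zero_mul]

lemma quadSym_sq (u : RatFunc K) {f : K[X]} (hf : IsCoprime f u.denom) :
    quadSym u f * quadSym u f = 1 := by
  classical
  rw [quadSym, if_pos hf, ← Multiset.prod_map_mul]
  apply Multiset.prod_eq_one
  intro x hx
  obtain ⟨P, -, rfl⟩ := Multiset.mem_map.1 hx
  split_ifs <;> norm_num

lemma quadSym_not_coprime (u : RatFunc K) {f : K[X]} (hf : ¬ IsCoprime f u.denom) :
    quadSym u f = 0 := by
  rw [quadSym, if_neg hf]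

variable [Finite K] [Algebra (ZMod 2) K]

lemma IData.solvable_iff {u : RatFunc K} {N E b : K[X]} {g : ℕ} (h : IData u N E b g)
    {P κ : K[X]} (hP : P.Monic) (hi : Irreducible P) (hd : ¬ P ∣ u.denom)
    (hκ : P ∣ κ * N ^ 2 - 1) :
    hasseSolvable u P ↔ Algebra.trace (ZMod 2) K (res P (κ * (E * derivative P))) = 0 := by
  have : Fact (Irreducible P) := ⟨hi⟩
  have : FiniteDimensional K (AdjoinRoot P) := (AdjoinRoot.powerBasis hP.ne_zero).finite
  have : Finite (AdjoinRoot P) := Module.finite_of_finite K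
  rw [← mul_assoc, ← trace_eq_res hP hi]
  have htt : Algebra.trace (ZMod 2) K (Algebra.trace K (AdjoinRoot P) (AdjoinRoot.mk P (κ * E))) =
    Algebra.trace (ZMod 2) (AdjoinRoot P) (AdjoinRoot.mk P (κ * E)) := Algebra.trace_trace _
  rw [htt, ← artin_schreier, hasseSolvable]
  rw [(AdjoinRoot.mk_surjective (g := P)).exists]
  refine exists_congr fun x => ?_
  rw [← AdjoinRoot.mk_eq_zero]
  rw [← AdjoinRoot.mk_eq_zero] at hκ hd
  have h1 := congrArg (AdjoinRoot.mk P) h.num_denom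
  simp only [map_sub, map_mul, map_pow, map_one, map_add] at *
  generalize AdjoinRoot.mk P x = x at *
  generalize AdjoinRoot.mk P u.denom = d at *
  generalize AdjoinRoot.mk P u.num = m at *
  generalize AdjoinRoot.mk P N = n at *
  generalize AdjoinRoot.mk P E = e at *
  generalize AdjoinRoot.mk P κ = k at *
  constructor
  · intro hx
    apply mul_right_cancel₀ hd
    linear_combination hx + k * h1 - m * hκ
  · intro hx
    linear_combination d * hx - k * h1 + m * hκ

lemma IData.quadSym_eq {u : RatFunc K} {N E b : K[X]} {g : ℕ} [CharP K 2] (h : IData u N E b g)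
    {f κ μ : K[X]} (hf : f.Monic) (hκ : κ * N ^ 2 + μ * f = 1) :
    quadSym u f = psi (res f (κ * (E * derivative f))) := by
  classical
  have hcop : IsCoprime f N := by
    have : IsCoprime f (N ^ 2) := ⟨μ, κ, by linear_combination hκ⟩
    exact (IsCoprime.pow_right_iff (by norm_num)).1 this
  have hmon : ∀ P ∈ normalizedFactors f, P.Monic := fun P hP =>
    (by
      have h1 := normalize_normalized_factor P hP
      have h2 : P ≠ 0 := (irreducible_of_normalized_factor P hP).ne_zero
      rw [← h1]; exact monic_normalize h2)
  have hprod : (normalizedFactors f).prod = f := by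
    rw [prod_normalizedFactors_eq hf.ne_zero, hf.normalize_eq_self]
  have hcd := (h.coprime_iff f).2 hcop
  rw [quadSym, if_pos hcd]
  have h1 := res_log_sum (κ * E) (normalizedFactors f) hmon
  rw [hprod] at h1
  rw [← mul_assoc, h1, psi_multiset_sum]
  congr 1
  refine Multiset.map_congr rfl fun P hP => ?_
  have hi := irreducible_of_normalized_factor P hP
  have hPf := dvd_of_mem_normalizedFactors hP
  have hd : ¬ P ∣ u.denom := fun hd => hi.not_isUnit (hcd.isUnit_of_dvd' hPf hd)
  have := h.solvable_iff (hmon P hP) hi hd (κ := κ)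
    ((hPf.trans (dvd_mul_left f μ)).trans ⟨-1, by linear_combination hκ⟩)
  rw [psi, mul_assoc]
  simp only [this]

end Symbol

section Family

variable {K : Type} [Field K] [Finite K] [CharP K 2]

lemma exists_sq_derivative (E : K[X]) : ∃ b : K[X], derivative E = b ^ 2 := by
  have h2 : derivative (derivative E) = 0 := by
    ext n
    rw [coeff_derivative, coeff_derivative, coeff_zero]
    have : ((n + 1 + 1 : ℕ) : K) * ((n + 1 : ℕ) : K) = 0 := by
      rw [← Nat.cast_mul, CharP.cast_eq_zero_iff K 2]
      rw [mul_comm]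
      exact (Nat.even_mul_succ_self (n + 1)).two_dvd
    push_cast at this ⊢
    linear_combination E.coeff (n + 1 + 1) * this
  have : Fact (Nat.Prime 2) := ⟨Nat.prime_two⟩
  rw [← expand_contract 2 h2 two_ne_zero, polynomial_expand_eq]
  exact ⟨_, rfl⟩

lemma not_dvd_derivative {P : K[X]} (hi : Irreducible P) : ¬ P ∣ derivative P := by
  intro h
  have h1 : P.Separable := PerfectField.separable_of_irreducible hi
  exact hi.not_isUnit (IsCoprime.isUnit_of_dvd' h1 dvd_rfl h)

lemma Gfam_facts {ξ : K} {s : ℕ} (hs : 1 ≤ s) {G : K[X]} (hG : G ∈ Gfam ξ s) :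
    G.natDegree ≤ 2 * s - 1 ∧ (derivative G).natDegree = 2 * s - 2 ∧ derivative G ≠ 0 := by
  obtain ⟨α, c, -, hc, hG⟩ := hG
  have h1 : G.natDegree ≤ 2 * s - 1 := by
    rw [hG]
    refine (natDegree_add_le _ _).trans (max_le (by simp) ?_)
    refine natDegree_sum_le_of_forall_le _ _ fun i hi => ?_
    rw [Finset.mem_Icc] at hi
    exact (natDegree_C_mul_X_pow_le _ _).trans (by omega)
  have h2 : G.coeff (2 * s - 1) = c s := by
    rw [hG, coeff_add, coeff_C_of_ne_zero (by omega), zero_add, finsetSum_coeff,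
      Finset.sum_eq_single s]
    · simp
    · intro i hi hne
      rw [Finset.mem_Icc] at hi
      rw [coeff_C_mul_X_pow, if_neg (by omega)]
    · intro h; exact absurd (Finset.mem_Icc.2 ⟨hs, le_rfl⟩) h
  have h3 : (derivative G).coeff (2 * s - 2) = c s := by
    rw [coeff_derivative, show 2 * s - 2 + 1 = 2 * s - 1 by omega, h2]
    have : ((2 * s - 2 : ℕ) : K) = 0 := by
      rw [CharP.cast_eq_zero_iff K 2]; omega
    rw [this]; ring
  refine ⟨h1, le_antisymm ?_ ?_, ?_⟩
  · exact (natDegree_derivative_le G).trans (by omega)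
  · exact le_natDegree_of_ne_zero (by rw [h3]; exact hc)
  · intro h0; rw [h0, coeff_zero] at h3; exact hc h3.symm

lemma exists_IData {ξ : K} {g : ℕ} {u : RatFunc K} (hu : u ∈ Ifam ξ (g + 1)) :
    ∃ N E b, IData u N E b g := by
  classical
  simp only [Ifam, Set.mem_iUnion] at hu
  obtain ⟨r, s, hs, hrs, v, ⟨S, e, a, hS, he, ha, ha0, hr, hv⟩, G, hG, rfl⟩ := hu
  obtain ⟨hG1, hG2, hG3⟩ := Gfam_facts hs hG
  set N : K[X] := ∏ P ∈ S, P ^ e P with hNdef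
  have hN : N.Monic := monic_prod_of_monic _ _ fun P hP => (hS P hP).1.pow _
  have hNr : N.natDegree = r := by
    rw [hNdef, natDegree_prod_of_monic _ _ fun P hP => (hS P hP).1.pow _, ← hr]
    exact Finset.sum_congr rfl fun P hP => (hS P hP).1.natDegree_pow _
  let cof : K[X] → ℕ → K[X] := fun P i => (∏ Q ∈ S.erase P, Q ^ e Q) * P ^ (e P - i)
  have hcof : ∀ P ∈ S, ∀ i ≤ e P, cof P i * P ^ i = N := by
    intro P hP i hi
    rw [hNdef, ← Finset.mul_prod_erase S _ hP]
    simp only [cof]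
    rw [mul_assoc, ← pow_add, Nat.sub_add_cancel hi, mul_comm]
  have hcofm : ∀ P ∈ S, ∀ i, (cof P i).Monic := fun P hP i =>
    (monic_prod_of_monic _ _ fun Q hQ => (hS Q (Finset.mem_of_mem_erase hQ)).1.pow _).mul
      ((hS P hP).1.pow _)
  have hcofd : ∀ P ∈ S, ∀ i ≤ e P, (cof P i).natDegree + i * P.natDegree = r := by
    intro P hP i hi
    rw [← hNr, ← hcof P hP i hi, (hcofm P hP i).natDegree_mul ((hS P hP).1.pow _),
      (hS P hP).1.natDegree_pow]
  have hcofdvd : ∀ P ∈ S, ∀ Q ∈ S, Q ≠ P → ∀ i, P ∣ cof Q i := by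
    intro P hP Q hQ hne i
    refine Dvd.dvd.mul_right ?_ _
    refine (dvd_pow_self P (by have := he P hP; omega)).trans
      (Finset.dvd_prod_of_mem (fun Q => Q ^ e Q) (Finset.mem_erase.2 ⟨hne.symm, hP⟩))
  set E₀ : K[X] := ∑ P ∈ S, ∑ i ∈ Finset.Icc 1 (e P), a P i * P * cof P i ^ 2 with hE₀
  have haP : ∀ P ∈ S, ∀ i ∈ Finset.Icc 1 (e P), (a P i * P * cof P i ^ 2).degree < (2 * r : ℕ) ∧
      (derivative (a P i * P) * cof P i ^ 2).degree < (2 * r : ℕ) := by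
    intro P hP i hi
    rw [Finset.mem_Icc] at hi
    have h1 := hcofd P hP i hi.2
    have h2 := ha P hP i hi.1 hi.2
    have h3 : P.natDegree ≤ i * P.natDegree := Nat.le_mul_of_pos_left _ hi.1
    have h4 : (cof P i ^ 2).natDegree = 2 * (cof P i).natDegree := (hcofm P hP i).natDegree_pow 2
    by_cases h0 : a P i = 0
    · rw [h0]
      constructor <;> simp only [zero_mul, derivative_zero, degree_zero] <;> exact WithBot.bot_lt_coe _
    have h5 : (a P i).natDegree < P.natDegree := natDegree_lt_natDegree h0 h2
    have h6 := natDegree_mul_le (p := a P i) (q := P)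
    have h7 := natDegree_derivative_le (a P i * P)
    constructor
    · refine lt_of_le_of_lt degree_le_natDegree (Nat.cast_lt.2 ?_)
      have := natDegree_mul_le (p := a P i * P) (q := cof P i ^ 2)
      omega
    · refine lt_of_le_of_lt degree_le_natDegree (Nat.cast_lt.2 ?_)
      have := natDegree_mul_le (p := derivative (a P i * P)) (q := cof P i ^ 2)
      omega
  have hE₀d : E₀.degree < (2 * r : ℕ) := by
    refine (degree_sum_le _ _).trans_lt ((Finset.sup_lt_iff (WithBot.bot_lt_coe _)).2 fun P hP => ?_)
    exact (degree_sum_le _ _).trans_lt ((Finset.sup_lt_iff (WithBot.bot_lt_coe _)).2 fun i hi => (haP P hP i hi).1)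
  have hderE₀ : derivative E₀ = ∑ P ∈ S, ∑ i ∈ Finset.Icc 1 (e P), derivative (a P i * P) * cof P i ^ 2 := by
    rw [hE₀, derivative_sum]
    refine Finset.sum_congr rfl fun P _ => ?_
    rw [derivative_sum]
    refine Finset.sum_congr rfl fun i _ => ?_
    rw [derivative_mul, derivative_sq', mul_zero, add_zero]
  have hE₀d' : (derivative E₀).degree < (2 * r : ℕ) := by
    rw [hderE₀]
    refine (degree_sum_le _ _).trans_lt ((Finset.sup_lt_iff (WithBot.bot_lt_coe _)).2 fun P hP => ?_)
    exact (degree_sum_le _ _).trans_lt ((Finset.sup_lt_iff (WithBot.bot_lt_coe _)).2 fun i hi => (haP P hP i hi).2)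
  have hN2 : (N ^ 2).natDegree = 2 * r := by rw [hN.natDegree_pow, hNr]
  set E := E₀ + N ^ 2 * G with hE
  have hderE : derivative E = derivative E₀ + N ^ 2 * derivative G := by
    rw [hE, derivative_add, derivative_mul, derivative_sq', zero_mul, zero_add]
  obtain ⟨b, hb⟩ := exists_sq_derivative E
  have hdeg : (derivative E).natDegree = 2 * g ∧ derivative E ≠ 0 := by
    have h1 : (N ^ 2 * derivative G).natDegree = 2 * g := by
      rw [(hN.pow 2).natDegree_mul' hG3, hN2, hG2]; omega
    have h2 : N ^ 2 * derivative G ≠ 0 := mul_ne_zero (hN.pow 2).ne_zero hG3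
    have h3 : (derivative E₀).degree < (N ^ 2 * derivative G).degree := by
      refine hE₀d'.trans_le ?_
      rw [degree_eq_natDegree h2, h1]
      exact_mod_cast (by omega)
    rw [hderE]
    refine ⟨by rw [natDegree_add_eq_right_of_degree_lt h3, h1], fun h => ?_⟩
    have := degree_add_eq_right_of_degree_lt h3
    rw [h, degree_zero] at this
    exact h2 (degree_eq_bot.1 this.symm)
  have hPE : ∀ P ∈ S, P ∣ E := by
    intro P hP
    refine dvd_add (Finset.dvd_sum fun Q hQ => Finset.dvd_sum fun i hi => ?_) ?_
    · by_cases hne : Q = P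
      · subst hne; exact Dvd.dvd.mul_right (dvd_mul_left _ _) _
      · exact Dvd.dvd.mul_left ((hcofdvd P hP Q hQ hne i).trans (dvd_pow_self _ two_ne_zero)) _
    · refine Dvd.dvd.mul_right ?_ _
      refine Dvd.dvd.trans ?_ (dvd_pow_self N two_ne_zero)
      exact (dvd_pow_self P (by have := he P hP; omega)).trans (Finset.dvd_prod_of_mem (fun Q => Q ^ e Q) hP)
  have hb0 : b ≠ 0 := by
    rintro rfl; exact hdeg.2 (by rw [hb]; simp)
  refine ⟨N, E, b, hN, ?_, hb, ?_, ?_, hb0, ?_, by omega, ?_⟩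
  · rw [hE, hE₀, hv, add_mul, map_add, map_sum, Finset.sum_mul]
    congr 1
    · refine Finset.sum_congr rfl fun P hP => ?_
      rw [map_sum, Finset.sum_mul]
      refine Finset.sum_congr rfl fun i hi => ?_
      rw [Finset.mem_Icc] at hi
      rw [← hcof P hP i hi.2]
      have hP0 : algebraMap K[X] (RatFunc K) P ≠ 0 := by
        simpa using (hS P hP).1.ne_zero
      simp only [map_mul, map_pow]
      rw [div_mul_eq_mul_div, div_eq_iff (pow_ne_zero _ hP0)]
      obtain ⟨k, rfl⟩ : ∃ k, i = k + 1 := ⟨i - 1, by omega⟩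
      rw [show 2 * (k + 1) - 1 = 2 * k + 1 by omega]
      ring
    · simp only [map_mul, map_pow]; ring
  · rw [hNdef, derivative_prod_finset, Finset.mul_sum]
    refine Finset.dvd_sum fun P hP => ?_
    obtain ⟨F, hF⟩ := hPE P hP
    rw [hF, derivative_pow]
    refine ⟨F * (C (e P : K) * derivative P), ?_⟩
    rw [← Finset.mul_prod_erase S _ hP]
    have : P ^ e P = P * P ^ (e P - 1) := by
      rw [← pow_succ', Nat.sub_add_cancel (he P hP)]
    rw [this]; ring
  · refine isCoprime_of_prime_dvd (fun h => hb0 h.1) ?_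
    intro π hπ hπb hπN
    obtain ⟨P, hP, hπP⟩ := hπ.exists_mem_finset_dvd hπN
    have hass := hπ.irreducible.associated_of_dvd (hS P hP).2 (hπ.dvd_of_dvd_pow hπP)
    have hi := (hS P hP).2
    have hPb : P ∣ b := hass.symm.dvd.trans hπb
    have hPE' : P ∣ derivative E := by rw [hb]; exact hPb.trans (dvd_pow_self _ two_ne_zero)
    have hPN : P ∣ N := (dvd_pow_self P (by have := he P hP; omega)).trans
      (Finset.dvd_prod_of_mem (fun Q => Q ^ e Q) hP)
    rw [hderE] at hPE'
    have h1 : P ∣ derivative E₀ := (dvd_add_left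
      (Dvd.dvd.mul_right (hPN.trans (dvd_pow_self N two_ne_zero)) _)).1 hPE'
    rw [hderE₀, ← Finset.add_sum_erase S _ hP] at h1
    have h2 : P ∣ ∑ i ∈ Finset.Icc 1 (e P), derivative (a P i * P) * cof P i ^ 2 := by
      refine (dvd_add_left (Finset.dvd_sum fun Q hQ => Finset.dvd_sum fun i _ => ?_)).1 h1
      rw [Finset.mem_erase] at hQ
      exact Dvd.dvd.mul_left ((hcofdvd P hP Q hQ.2 hQ.1 i).trans (dvd_pow_self _ two_ne_zero)) _
    rw [← Finset.add_sum_erase _ _ (Finset.mem_Icc.2 ⟨he P hP, le_rfl⟩)] at h2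
    have h3 : P ∣ derivative (a P (e P) * P) * cof P (e P) ^ 2 := by
      refine (dvd_add_left (Finset.dvd_sum fun i hi' => ?_)).1 h2
      rw [Finset.mem_erase, Finset.mem_Icc] at hi'
      refine Dvd.dvd.mul_left (Dvd.dvd.trans ?_ (dvd_pow_self _ two_ne_zero)) _
      exact Dvd.dvd.mul_left (dvd_pow_self P (by omega)) _
    rcases hi.prime.dvd_or_dvd h3 with h4 | h4
    · rw [derivative_mul] at h4
      have h5 : P ∣ a P (e P) * derivative P := (dvd_add_right (dvd_mul_left _ _)).1 h4
      rcases hi.prime.dvd_or_dvd h5 with h6 | h6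
      · exact absurd (degree_le_of_dvd h6 (ha0 P hP)) (not_le.2 (ha P hP _ (he P hP) le_rfl))
      · exact not_dvd_derivative hi h6
    · have h5 := hi.prime.dvd_of_dvd_pow h4
      simp only [cof, Nat.sub_self, pow_zero, mul_one] at h5
      obtain ⟨Q, hQ, h6⟩ := hi.prime.exists_mem_finset_dvd h5
      rw [Finset.mem_erase] at hQ
      have h7 := hi.associated_of_dvd (hS Q hQ.2).2 (hi.prime.dvd_of_dvd_pow h6)
      exact hQ.1 (eq_of_monic_of_associated (hS Q hQ.2).1 (hS P hP).1 h7.symm)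
  · have := hdeg.1
    rw [hb, natDegree_pow] at this
    omega
  · rw [hE]
    refine (natDegree_add_le _ _).trans (max_le ?_ ?_)
    · have := natDegree_le_of_degree_le hE₀d.le
      omega
    · have := natDegree_mul_le (p := N ^ 2) (q := G)
      omega

end Family

section Main

variable {K : Type} [Field K]

lemma degree_mul_lt_of {N x : K[X]} {k : ℕ} (hN : N.Monic) (hx : x.degree < (k : WithBot ℕ)) :
    (N * x).degree < ((N.natDegree + k : ℕ) : WithBot ℕ) := by
  by_cases h0 : x = 0
  · subst h0; simp only [mul_zero, degree_zero]; exact WithBot.bot_lt_coe _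
  rw [← natDegree_lt_iff_degree_lt h0] at hx
  rw [← natDegree_lt_iff_degree_lt (mul_ne_zero hN.ne_zero h0), hN.natDegree_mul' h0]
  omega

lemma degree_lt_of_mul {N x : K[X]} {k : ℕ} (hN : N.Monic)
    (hx : (N * x).degree < ((N.natDegree + k : ℕ) : WithBot ℕ)) : x.degree < (k : WithBot ℕ) := by
  by_cases h0 : x = 0
  · subst h0; simp only [degree_zero]; exact WithBot.bot_lt_coe _
  rw [← natDegree_lt_iff_degree_lt (mul_ne_zero hN.ne_zero h0), hN.natDegree_mul' h0] at hx
  rw [← natDegree_lt_iff_degree_lt h0]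
  omega

lemma monic_add_of {f y : K[X]} {n : ℕ} (hf : f.Monic) (hn : f.natDegree = n)
    (hy : y.degree < (n : WithBot ℕ)) : (f + y).Monic ∧ (f + y).natDegree = n := by
  have h : y.degree < f.degree := by rwa [degree_eq_natDegree hf.ne_zero, hn]
  exact ⟨hf.add_of_left h, by rw [natDegree_add_eq_left_of_degree_lt h, hn]⟩

lemma deg_mono {y : K[X]} {a c : ℕ} (hy : y.degree < (a : WithBot ℕ)) (h : a ≤ c) :
    y.degree < (c : WithBot ℕ) := hy.trans_le (by exact_mod_cast h)

lemma exists_bezout {f N : K[X]} (h : IsCoprime f N) : ∃ κ μ : K[X], κ * N ^ 2 + μ * f = 1 := by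
  obtain ⟨a, c, h⟩ := h.pow_right (n := 2)
  exact ⟨c, a, by linear_combination h⟩

lemma isCoprime_shift {f N : K[X]} (h : IsCoprime f N) (x : K[X]) : IsCoprime (f + N * x) N := by
  exact IsCoprime.add_mul_left_left h x

/-- The relation pairing monic `f` of degree `2g - m` with monic `h` of degree `m`. -/
def rel (N β : K[X]) (g : ℕ) (f h : K[X]) : Prop :=
  ∃ c : K[X], c.degree < (g : WithBot ℕ) ∧ f * h = β ^ 2 + N * c

lemma rel_coprime {N β f h : K[X]} {g : ℕ} (hβ : IsCoprime β N) (hr : rel N β g f h) :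
    IsCoprime f N ∧ IsCoprime h N := by
  obtain ⟨c, -, hc⟩ := hr
  have h1 := isCoprime_shift (hβ.pow_left (m := 2)) c
  rw [← hc] at h1
  exact ⟨h1.of_mul_left_left, h1.of_mul_left_right⟩

lemma rel_unique {N β f h h1 : K[X]} {g n : ℕ} (hN : N.Monic) (hβ : IsCoprime β N)
    (hf : f.Monic) (hn : f.natDegree = n) (hgn : g ≤ n)
    (hr : rel N β g f h) (hr1 : rel N β g f h1) : h = h1 := by
  have hcop := (rel_coprime hβ hr).1
  obtain ⟨c, hc, e⟩ := hr
  obtain ⟨c1, hc1, e1⟩ := hr1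
  obtain ⟨w, hw⟩ : N ∣ h - h1 := by
    refine hcop.symm.dvd_of_dvd_mul_left (y := f) (z := h - h1) ⟨c - c1, ?_⟩
    linear_combination e - e1
  by_contra hne
  have hw0 : w ≠ 0 := by
    rintro rfl; exact hne (by linear_combination hw)
  have h2 : f * w = c - c1 := by
    apply mul_left_cancel₀ hN.ne_zero
    linear_combination e - e1 - f * hw
  have h3 : (f * w).degree < (g : WithBot ℕ) := by
    rw [h2]; exact (degree_sub_le _ _).trans_lt (max_lt hc hc1)
  rw [← natDegree_lt_iff_degree_lt (mul_ne_zero hf.ne_zero hw0), hf.natDegree_mul' hw0] at h3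
  omega

lemma rel_exists {N β h : K[X]} {g m n : ℕ} (hN : N.Monic) (hNg : N.natDegree ≤ g)
    (hβ : β.Monic) (hβg : β.natDegree = g) (hh : h.Monic) (hm : h.natDegree = m) (hmg : m ≤ g)
    (hn : n + m = 2 * g) (hcop : IsCoprime h N) :
    ∃ f : K[X], (f.Monic ∧ f.natDegree = n) ∧ rel N β g f h := by
  obtain ⟨κ, μ, hκ⟩ := hcop
  set Q := β ^ 2 /ₘ h with hQ
  set R := β ^ 2 %ₘ h with hR
  have h1 : R + h * Q = β ^ 2 := modByMonic_add_div (β ^ 2) h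
  have hRd : R.degree < (m : WithBot ℕ) := by
    rw [← hm, ← degree_eq_natDegree hh.ne_zero]; exact degree_modByMonic_lt _ hh
  have hβ2 : (β ^ 2).natDegree = 2 * g := by rw [hβ.natDegree_pow, hβg]
  have h2 := monic_add_of (y := -R) (hβ.pow 2) hβ2 (by rw [degree_neg]; exact deg_mono hRd (by omega))
  rw [show β ^ 2 + -R = h * Q by linear_combination -h1] at h2
  have hQm : Q.Monic := hh.of_mul_monic_left h2.1
  have hQd : Q.natDegree = n := by
    have := h2.2
    rw [hh.natDegree_mul hQm] at this
    omega
  set δ := (R * κ) %ₘ N with hδ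
  have hδd : δ.degree < (N.natDegree : WithBot ℕ) := by
    rw [← degree_eq_natDegree hN.ne_zero]; exact degree_modByMonic_lt _ hN
  refine ⟨Q + δ, monic_add_of hQm hQd (deg_mono hδd (by omega)), ?_⟩
  have h3 : δ + N * ((R * κ) /ₘ N) = R * κ := modByMonic_add_div (R * κ) N
  set w := (R * κ) /ₘ N
  have h4 : h * δ - R = N * (-(R * μ + h * w)) := by
    linear_combination h * h3 + R * hκ
  refine ⟨-(R * μ + h * w), degree_lt_of_mul hN ?_, ?_⟩
  · rw [← h4]
    refine (degree_sub_le _ _).trans_lt (max_lt ?_ (deg_mono hRd (by omega)))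
    exact deg_mono (degree_mul_lt_of hh hδd) (by omega)
  · linear_combination h1 + h4

lemma rel_iff {N β h f₀ : K[X]} {g m n : ℕ} (hN : N.Monic) (hNg : N.natDegree ≤ g)
    (hh : h.Monic) (hm : h.natDegree = m) (hmg : m ≤ g)
    (hn : n + m = 2 * g) (hcop : IsCoprime h N) (hf₀ : f₀.Monic ∧ f₀.natDegree = n)
    (hr : rel N β g f₀ h) (f : K[X]) :
    ((f.Monic ∧ f.natDegree = n) ∧ rel N β g f h) ↔
      ∃ y : K[X], y.degree < ((g - m : ℕ) : WithBot ℕ) ∧ f₀ + N * y = f := by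
  obtain ⟨c₀, hc₀, e₀⟩ := hr
  constructor
  · rintro ⟨-, c, hc, e⟩
    obtain ⟨y, hy⟩ : N ∣ f - f₀ := by
      refine hcop.symm.dvd_of_dvd_mul_right (y := f - f₀) (z := h) ⟨c - c₀, ?_⟩
      linear_combination e - e₀
    refine ⟨y, ?_, by linear_combination -hy⟩
    have h2 : h * y = c - c₀ := by
      apply mul_left_cancel₀ hN.ne_zero
      linear_combination e - e₀ - h * hy
    refine degree_lt_of_mul hh ?_
    rw [h2, hm, Nat.add_sub_cancel' hmg]
    exact (degree_sub_le _ _).trans_lt (max_lt hc hc₀)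
  · rintro ⟨y, hy, rfl⟩
    refine ⟨monic_add_of hf₀.1 hf₀.2 (deg_mono (degree_mul_lt_of hN hy) (by omega)), c₀ + h * y, ?_, ?_⟩
    · refine (degree_add_le _ _).trans_lt (max_lt hc₀ (deg_mono (degree_mul_lt_of hh hy) (by omega)))
    · linear_combination e₀

section Finite

variable [Finite K]

lemma finite_low (n : ℕ) : {x : K[X] | x.degree < (n : WithBot ℕ)}.Finite := by
  have : Finite (degreeLT K n) := Module.finite_of_finite K
  refine (Set.toFinite ((degreeLT K n : Submodule K K[X]) : Set K[X])).subset fun x hx => ?_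
  exact mem_degreeLT.2 hx

lemma finite_mon (n : ℕ) : {f : K[X] | f.Monic ∧ f.natDegree = n}.Finite := by
  refine (finite_low (n + 1)).subset fun f hf => ?_
  exact degree_le_natDegree.trans_lt (Nat.cast_lt.2 (by rw [hf.2]; omega))

variable (K) in
/-- Polynomials of degree less than `n`. -/
def low (n : ℕ) : Finset K[X] := (finite_low (K := K) n).toFinset

variable (K) in
/-- Monic polynomials of degree `n`. -/
def mon (n : ℕ) : Finset K[X] := (finite_mon (K := K) n).toFinset

lemma mem_low {n : ℕ} {x : K[X]} : x ∈ low K n ↔ x.degree < (n : WithBot ℕ) := by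
  simp [low]

lemma mem_mon {n : ℕ} {f : K[X]} : f ∈ mon K n ↔ f.Monic ∧ f.natDegree = n := by
  simp [mon]

lemma card_low (n : ℕ) : (low K n).card = Nat.card K ^ n := by
  have h1 : Nat.card (degreeLT K n) = Nat.card K ^ n := by
    rw [Nat.card_congr (degreeLTEquiv K n).toEquiv, Nat.card_fun, Nat.card_fin]
  rw [← h1, low, ← Set.ncard_eq_toFinset_card _ (finite_low n), ← Nat.card_coe_set_eq]
  refine Nat.card_congr (Equiv.subtypeEquivRight fun x => ?_)
  exact mem_degreeLT.symm

lemma card_rel {N β h : K[X]} {g m n : ℕ} (hN : N.Monic) (hNg : N.natDegree ≤ g)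
    (hβ : β.Monic) (hβg : β.natDegree = g) (hh : h ∈ mon K m) (hmg : m ≤ g)
    (hn : n + m = 2 * g) (hcop : IsCoprime h N) [DecidablePred fun f => rel N β g f h] :
    ((mon K n).filter fun f => rel N β g f h).card = Nat.card K ^ (g - m) := by
  classical
  rw [mem_mon] at hh
  obtain ⟨f₀, hf₀, hr⟩ := rel_exists (n := n) hN hNg hβ hβg hh.1 hh.2 hmg hn hcop
  rw [← card_low, ← Finset.card_image_of_injective (s := low K (g - m)) (f := fun y => f₀ + N * y)]
  · congr 1
    ext f
    rw [Finset.mem_filter, mem_mon, rel_iff hN hNg hh.1 hh.2 hmg hn hcop hf₀ hr, Finset.mem_image]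
    simp only [mem_low]
  · intro y y' hy
    exact mul_left_cancel₀ hN.ne_zero (add_left_cancel hy)

variable [Algebra (ZMod 2) K] [CharP K 2] {u : RatFunc K} {N E b : K[X]} {g : ℕ}

lemma IData.shift (h : IData u N E b g) {f κ μ x : K[X]} {n : ℕ} (hf : f.Monic)
    (hn : f.natDegree = n) (hgn : g ≤ n) (hκ : κ * N ^ 2 + μ * f = 1)
    (hx : x.degree < ((n - g : ℕ) : WithBot ℕ)) :
    quadSym u (f + N * x) = quadSym u f * psi (res f (κ * N * (b ^ 2 * x))) := by
  by_cases hx0 : x = 0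
  · subst hx0; simp [psi_zero]
  have hlt : g < n := by
    rw [← natDegree_lt_iff_degree_lt hx0] at hx; omega
  have hNg := h.N_deg
  have hEg := h.E_deg
  have hd := degree_mul_lt_of h.monic hx
  obtain ⟨hm2, hn2⟩ := monic_add_of hf hn (deg_mono hd (by omega))
  have hcop : IsCoprime f N := by
    have : IsCoprime f (N ^ 2) := ⟨μ, κ, by linear_combination hκ⟩
    exact (IsCoprime.pow_right_iff (by norm_num)).1 this
  obtain ⟨κ', μ', hκ'⟩ := exists_bezout (isCoprime_shift hcop x)
  rw [h.quadSym_eq hf hκ, h.quadSym_eq hm2 hκ', ← psi_add]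
  rw [variation (d := g + 1 - N.natDegree) h.monic hf hm2 hn hn2 h.deriv (by omega) h.dvd
    (deg_mono hd (by omega)) (by omega) (by omega) hκ hκ']

lemma IData.rel_eq (h : IData u N E b g) {l : K} {β f k : K[X]} (hβ : β.Monic)
    (hb : b = C l * β) (hβg : β.natDegree = g) (hβN : IsCoprime β N) (hf : f ≠ 0) (hk : k ≠ 0)
    (hr : rel N β g f k) : quadSym u f = quadSym u k := by
  obtain ⟨-, hkN⟩ := rel_coprime hβN hr
  obtain ⟨c, hc, e⟩ := hr
  obtain ⟨κ, μ, hκ⟩ := exists_bezout (hβN.pow_left (m := 2))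
  have h1 := h.shift (x := c) (n := 2 * g) (hβ.pow 2) (by rw [hβ.natDegree_pow, hβg]) (by omega) hκ
    (by rwa [show 2 * g - g = g by omega])
  rw [res_dvd (hβ.pow 2) ⟨κ * N * (C l ^ 2 * c), by rw [hb]; ring⟩, psi_zero, mul_one, ← e,
    pow_two, quadSym_mul u hβ.ne_zero hβ.ne_zero, quadSym_sq u ((h.coprime_iff β).2 hβN),
    quadSym_mul u hf hk] at h1
  have h2 := quadSym_sq u ((h.coprime_iff k).2 hkN)
  linear_combination quadSym u k * h1 - quadSym u f * h2

lemma IData.lambda_zero (h : IData u N E b g) {l : K} {β f k κ μ x : K[X]} {n : ℕ}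
    (hb : b = C l * β) (hf : f.Monic)
    (hn : f.natDegree = n) (hκ : κ * N ^ 2 + μ * f = 1)
    (hx : x.degree < ((n - g : ℕ) : WithBot ℕ)) (hr : rel N β g f k) :
    res f (κ * N * (b ^ 2 * x)) = 0 := by
  obtain ⟨c, hc, e⟩ := hr
  rw [res_congr (A' := C (-l ^ 2) * (c * x)) hf]
  · refine res_of_degree_lt hf ?_
    by_cases h0 : C (-l ^ 2) * (c * x) = 0
    · rw [h0, degree_zero]; exact WithBot.bot_lt_coe _
    have h1 := right_ne_zero_of_mul h0
    have h2 := left_ne_zero_of_mul h1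
    have h3 := right_ne_zero_of_mul h1
    rw [← natDegree_lt_iff_degree_lt h2] at hc
    rw [← natDegree_lt_iff_degree_lt h3] at hx
    rw [← natDegree_lt_iff_degree_lt h0]
    have h4 := natDegree_C_mul_le (-l ^ 2) (c * x)
    have h5 := natDegree_mul_le (p := c) (q := x)
    omega
  · refine ⟨C l ^ 2 * x * (κ * N * k + μ * c), ?_⟩
    rw [hb, map_neg, map_pow]
    linear_combination -C l ^ 2 * x * κ * N * e - C l ^ 2 * x * c * hκ

lemma IData.lambda_ne (h : IData u N E b g) {l : K} {β f κ μ : K[X]} {n m : ℕ}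
    (hl : l ≠ 0) (hβ : β.Monic) (hb : b = C l * β) (hβg : β.natDegree = g) (hf : f.Monic)
    (hn : f.natDegree = n) (hnm : n + m = 2 * g) (hκ : κ * N ^ 2 + μ * f = 1)
    (hr : ¬ ∃ k ∈ mon K m, rel N β g f k) :
    ∃ x ∈ low K (n - g), psi (res f (κ * N * (b ^ 2 * x))) = -1 := by
  have hNg := h.N_deg
  set c := (κ * N * b ^ 2) %ₘ f with hc
  set w := (κ * N * b ^ 2) /ₘ f with hw
  have h1 : c + f * w = κ * N * b ^ 2 := modByMonic_add_div _ f
  have hcd : c.degree < (n : WithBot ℕ) := by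
    rw [← hn, ← degree_eq_natDegree hf.ne_zero]; exact degree_modByMonic_lt _ hf
  have hcg : ¬ c.degree < (g : WithBot ℕ) := by
    intro hcg
    apply hr
    have hCl : C (l⁻¹) * C l = (1 : K[X]) := by
      rw [← C_mul, inv_mul_cancel₀ hl, C_1]
    have e : f * (C (l⁻¹) ^ 2 * (μ * b ^ 2 + N * w)) = β ^ 2 + N * (-(C (l⁻¹ ^ 2) * c)) := by
      have h2 : C (l⁻¹) ^ 2 * b ^ 2 = β ^ 2 := by
        rw [hb]; linear_combination β ^ 2 * (C (l⁻¹) * C l + 1) * hCl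
      rw [C_pow]
      linear_combination h2 + C (l⁻¹) ^ 2 * N * h1 + C (l⁻¹) ^ 2 * b ^ 2 * hκ
    have hcd' : (-(C (l⁻¹ ^ 2) * c)).degree < (g : WithBot ℕ) := by
      rw [degree_neg, degree_C_mul (pow_ne_zero _ (inv_ne_zero hl))]; exact hcg
    have h3 := monic_add_of (hβ.pow 2) (by rw [hβ.natDegree_pow, hβg])
      (deg_mono (degree_mul_lt_of h.monic hcd') (by omega : _ ≤ 2 * g))
    rw [← e] at h3
    have hk := hf.of_mul_monic_left h3.1
    refine ⟨_, mem_mon.2 ⟨hk, ?_⟩, _, hcd', e⟩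
    have := h3.2
    rw [hf.natDegree_mul hk] at this
    omega
  have hc0 : c ≠ 0 := by
    intro h0; rw [h0, degree_zero] at hcg; exact hcg (WithBot.bot_lt_coe _)
  rw [← natDegree_lt_iff_degree_lt hc0] at hcd hcg
  obtain ⟨t, ht⟩ := Algebra.trace_surjective (ZMod 2) K 1
  have hlc : c.leadingCoeff ≠ 0 := leadingCoeff_ne_zero.2 hc0
  refine ⟨C (t / c.leadingCoeff) * X ^ (n - 1 - c.natDegree), mem_low.2 ?_, ?_⟩
  · exact (degree_C_mul_X_pow_le _ _).trans_lt (Nat.cast_lt.2 (by omega))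
  · set x := C (t / c.leadingCoeff) * X ^ (n - 1 - c.natDegree) with hx
    have h2 : res f (κ * N * (b ^ 2 * x)) = t := by
      rw [res_congr (A' := c * x) hf ⟨w * x, by linear_combination -x * h1⟩, res_apply,
        (modByMonic_eq_self_iff hf).2, hn, hx,
        show c * (C (t / c.leadingCoeff) * X ^ (n - 1 - c.natDegree)) =
          C (t / c.leadingCoeff) * (c * X ^ (n - 1 - c.natDegree)) by ring, coeff_C_mul,
        show n - 1 = c.natDegree + (n - 1 - c.natDegree) by omega,
        Nat.add_sub_cancel_left, coeff_mul_X_pow, coeff_natDegree, div_mul_cancel₀ _ hlc]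
      rw [degree_eq_natDegree hf.ne_zero, hn]
      refine degree_le_natDegree.trans_lt (Nat.cast_lt.2 ?_)
      have h3 := natDegree_mul_le (p := c) (q := x)
      have h4 : x.natDegree ≤ n - 1 - c.natDegree := natDegree_C_mul_X_pow_le _ _
      omega
    rw [h2, psi, ht, if_neg one_ne_zero]

open scoped Classical in
lemma IData.inner_sum (h : IData u N E b g) {l : K} {β f : K[X]} {n m : ℕ}
    (hl : l ≠ 0) (hβ : β.Monic) (hb : b = C l * β) (hβg : β.natDegree = g) (hf : f.Monic)
    (hn : f.natDegree = n) (hnm : n + m = 2 * g) (hgn : g ≤ n) :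
    ∑ x ∈ low K (n - g), quadSym u (f + N * x) =
      (low K (n - g)).card * (if ∃ k ∈ mon K m, rel N β g f k then quadSym u f else 0) := by
  by_cases hcop : IsCoprime f N
  swap
  · have h1 : quadSym u f = 0 := quadSym_not_coprime u fun h' => hcop ((h.coprime_iff f).1 h')
    rw [h1, ite_self, mul_zero]
    refine Finset.sum_eq_zero fun x _ => quadSym_not_coprime u fun h' => hcop ?_
    have := isCoprime_shift ((h.coprime_iff _).1 h') (-x)
    rwa [show f + N * x + N * -x = f by ring] at this
  obtain ⟨κ, μ, hκ⟩ := exists_bezout hcop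
  have h1 : ∑ x ∈ low K (n - g), quadSym u (f + N * x) =
      quadSym u f * ∑ x ∈ low K (n - g), psi (res f (κ * N * (b ^ 2 * x))) := by
    rw [Finset.mul_sum]
    exact Finset.sum_congr rfl fun x hx => h.shift hf hn hgn hκ (mem_low.1 hx)
  rw [h1]
  split_ifs with hc
  · obtain ⟨k, -, hk⟩ := hc
    rw [Finset.sum_congr rfl fun x hx => by
      rw [h.lambda_zero hb hf hn hκ (mem_low.1 hx) hk, psi_zero]]
    simp [mul_comm]
  · obtain ⟨x₀, hx₀, hp⟩ := h.lambda_ne hl hβ hb hβg hf hn hnm hκ hc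
    have h2 : ∑ x ∈ low K (n - g), psi (res f (κ * N * (b ^ 2 * x))) =
        ∑ x ∈ low K (n - g), psi (res f (κ * N * (b ^ 2 * (x + x₀)))) := by
      rw [mem_low] at hx₀
      symm
      refine Finset.sum_nbij' (fun x => x + x₀) (fun x => x - x₀) ?_ ?_ ?_ ?_ ?_
      · intro x hx
        rw [mem_low] at hx ⊢
        exact (degree_add_le _ _).trans_lt (max_lt hx hx₀)
      · intro x hx
        rw [mem_low] at hx ⊢
        exact (degree_sub_le _ _).trans_lt (max_lt hx hx₀)
      · intro x _; simp
      · intro x _; simp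
      · intro x _; rfl
    have h3 : ∑ x ∈ low K (n - g), psi (res f (κ * N * (b ^ 2 * (x + x₀)))) =
        - ∑ x ∈ low K (n - g), psi (res f (κ * N * (b ^ 2 * x))) := by
      rw [← Finset.sum_neg_distrib]
      refine Finset.sum_congr rfl fun x _ => ?_
      rw [mul_add, mul_add, map_add, psi_add, hp, mul_neg_one]
    rw [show ∑ x ∈ low K (n - g), psi (res f (κ * N * (b ^ 2 * x))) = 0 by linarith]
    simp

open scoped Classical in
lemma IData.sum_cond (h : IData u N E b g) {l : K} {β : K[X]} {n m : ℕ}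
    (hl : l ≠ 0) (hβ : β.Monic) (hb : b = C l * β) (hβg : β.natDegree = g)
    (hnm : n + m = 2 * g) (hgn : g ≤ n) :
    ∑ f ∈ mon K n, quadSym u f =
      ∑ f ∈ mon K n, if ∃ k ∈ mon K m, rel N β g f k then quadSym u f else 0 := by
  have hNg := h.N_deg
  have hcard : ((low K (n - g)).card : ℤ) ≠ 0 := by
    rw [card_low]
    exact_mod_cast pow_ne_zero _ Nat.card_pos.ne'
  apply mul_left_cancel₀ hcard
  have h1 : ∀ x ∈ low K (n - g), ∑ f ∈ mon K n, quadSym u (f + N * x) = ∑ f ∈ mon K n, quadSym u f := by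
    intro x hx
    rw [mem_low] at hx
    have hd := deg_mono (degree_mul_lt_of h.monic hx) (by omega : _ ≤ n)
    refine Finset.sum_nbij' (fun f => f + N * x) (fun f => f - N * x) ?_ ?_ ?_ ?_ ?_
    · intro f hf
      rw [mem_mon] at hf ⊢
      exact monic_add_of hf.1 hf.2 hd
    · intro f hf
      rw [mem_mon] at hf ⊢
      rw [sub_eq_add_neg]
      exact monic_add_of hf.1 hf.2 (by rwa [degree_neg])
    · intro x _; simp
    · intro x _; simp
    · intro x _; rfl
  rw [← nsmul_eq_mul, ← Finset.sum_const, ← Finset.sum_congr rfl h1, Finset.sum_comm, Finset.mul_sum]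
  refine Finset.sum_congr rfl fun f hf => ?_
  rw [mem_mon] at hf
  exact h.inner_sum hl hβ hb hβg hf.1 hf.2 hnm hgn

theorem IData.func_eq (h : IData u N E b g) {n m : ℕ} (hnm : n + m = 2 * g) (hmg : m ≤ g) :
    ∑ f ∈ mon K n, quadSym u f = (Nat.card K : ℤ) ^ (g - m) * ∑ f ∈ mon K m, quadSym u f := by
  classical
  set l := b.leadingCoeff with hldef
  have hl : l ≠ 0 := leadingCoeff_ne_zero.2 h.b_ne
  set β := C l⁻¹ * b with hβdef
  have hβ : β.Monic := by
    rw [hβdef, mul_comm]; exact monic_mul_leadingCoeff_inv h.b_ne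
  have hb : b = C l * β := by
    rw [hβdef, ← mul_assoc, ← C_mul, mul_inv_cancel₀ hl, C_1, one_mul]
  have hβg : β.natDegree = g := by
    rw [hβdef, natDegree_C_mul (inv_ne_zero hl), h.b_deg]
  have hβN : IsCoprime β N := by
    have := h.cop
    rw [hb] at this
    exact this.of_mul_left_right
  rw [h.sum_cond (m := m) hl hβ hb hβg hnm (by omega)]
  have h1 : ∀ f ∈ mon K n, (if ∃ k ∈ mon K m, rel N β g f k then quadSym u f else 0) =
      ∑ k ∈ mon K m, if rel N β g f k then quadSym u k else 0 := by
    intro f hf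
    rw [mem_mon] at hf
    split_ifs with hc
    · obtain ⟨k, hk, hr⟩ := hc
      rw [Finset.sum_eq_single k, if_pos hr,
        h.rel_eq hβ hb hβg hβN hf.1.ne_zero (mem_mon.1 hk).1.ne_zero hr]
      · intro k' _ hne
        rw [if_neg]
        intro hr'
        exact hne (rel_unique h.monic hβN hf.1 hf.2 (by omega) hr' hr)
      · intro h'; exact absurd hk h'
    · symm
      refine Finset.sum_eq_zero fun k hk => if_neg fun hr => hc ⟨k, hk, hr⟩
  rw [Finset.sum_congr rfl h1, Finset.sum_comm, Finset.mul_sum]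
  refine Finset.sum_congr rfl fun k hk => ?_
  by_cases hcop : IsCoprime k N
  · rw [← Finset.sum_filter, Finset.sum_const, card_rel h.monic h.N_deg hβ hβg hk hmg hnm hcop]
    simp
  · rw [quadSym_not_coprime u fun h' => hcop ((h.coprime_iff k).1 h')]
    simp

lemma Acoeff_eq (u : RatFunc K) (n : ℕ) : Acoeff u n = ((∑ f ∈ mon K n, quadSym u f : ℤ) : ℂ) := by
  have : Finite {f : K[X] // f.Monic ∧ f.natDegree = n} := (finite_mon n).to_subtype
  have := Fintype.ofFinite {f : K[X] // f.Monic ∧ f.natDegree = n}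
  rw [Acoeff, tsum_fintype, Int.cast_sum]
  symm
  exact Finset.sum_subtype _ (fun f => mem_mon) (fun f => (quadSym u f : ℂ))

end Finite

end Main

theorem statement9 {Fq : Type} [Field Fq] [Fintype Fq] (hchar : ringChar Fq = 2)
    (ξ : Fq) (hξ : ∀ x : Fq, x ^ 2 + x ≠ ξ) (g : ℕ) (u : RatFunc Fq)
    (hu : u ∈ Ifam ξ (g + 1)) (s : ℂ) (hs : (1 : ℝ) / 2 ≤ s.re) :
    Lfun (2 * g) u s =
      (∑ n ∈ Finset.range (g + 1),
        Acoeff u n * (Fintype.card Fq : ℂ) ^ (-(s * (n : ℂ)))) +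
      (Fintype.card Fq : ℂ) ^ ((1 - 2 * s) * (g : ℂ)) *
        ∑ n ∈ Finset.range g,
          Acoeff u n * (Fintype.card Fq : ℂ) ^ ((s - 1) * (n : ℂ)) := by
  have : CharP Fq 2 := ringChar.of_eq hchar
  letI : Algebra (ZMod 2) Fq := ZMod.algebra Fq 2
  obtain ⟨N, E, b, h⟩ := exists_IData hu
  have hq : (Fintype.card Fq : ℂ) ≠ 0 := by exact_mod_cast Fintype.card_ne_zero
  rw [Lfun, show 2 * g + 1 = (g + 1) + g by omega, Finset.sum_range_add]
  congr 1
  rw [← Finset.sum_range_reflect, Finset.mul_sum]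
  refine Finset.sum_congr rfl fun m hm => ?_
  rw [Finset.mem_range] at hm
  have h1 : g + 1 + (g - 1 - m) = 2 * g - m := by omega
  rw [h1]
  have h2 := h.func_eq (n := 2 * g - m) (m := m) (by omega) (by omega)
  rw [Acoeff_eq u (2 * g - m), h2, Int.cast_mul, ← Acoeff_eq, Int.cast_pow, Int.cast_natCast,
    Nat.card_eq_fintype_card, ← Complex.cpow_natCast, Nat.cast_sub (by omega : m ≤ 2 * g),
    Nat.cast_sub hm.le]
  have h3 : (Fintype.card Fq : ℂ) ^ ((g : ℂ) - m) *
      (Fintype.card Fq : ℂ) ^ (-(s * (((2 * g : ℕ) : ℂ) - m))) =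
      (Fintype.card Fq : ℂ) ^ ((1 - 2 * s) * (g : ℂ)) * (Fintype.card Fq : ℂ) ^ ((s - 1) * (m : ℂ)) := by
    rw [← Complex.cpow_add _ _ hq, ← Complex.cpow_add _ _ hq]
    congr 1
    push_cast
    ring
  linear_combination Acoeff u m * h3

end EvenChar
end
end

section
/- Fix a monic polynomial L ∈ A⁺ and ε > 0. Then there is a constant C > 0 such that for all n ≥ 1, |Σ_{f ∈ A⁺, deg f = n, gcd(f,L)=1} Φ(f) − ζ_A(2)^{−1} q^{2n} ∏_{P|L} (1 + |P|^{−1})^{−1}| ≤ C·q^{(1+ε)n}. -/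
open Polynomial UniqueFactorizationMonoid

noncomputable section

namespace FFArith

variable {Fq : Type} [Field Fq] [Fintype Fq]

/-- The Euler totient `Φ(f) = #(A/fA)ˣ` for `A = Fq[T]`. -/
def PhiA (f : Polynomial Fq) : ℕ :=
  Nat.card (Polynomial Fq ⧸ Ideal.span {f})ˣ

open scoped Classical in
/-- The Möbius function on `Fq[T]`. -/
def muA (D : Polynomial Fq) : ℤ :=
  if Squarefree D then (-1) ^ (normalizedFactors D).toFinset.card else 0

/-- `ζ_A(s) = (1 - q^{1-s})⁻¹`, real version. -/
def zetaR (q : ℕ) (s : ℝ) : ℝ := (1 - (q : ℝ) ^ ((1 : ℝ) - s))⁻¹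

/-- `ζ_A(s) = (1 - q^{1-s})⁻¹`, complex version. -/
def zetaC (q : ℕ) (s : ℂ) : ℂ := (1 - (q : ℂ) ^ ((1 : ℂ) - s))⁻¹

variable (Fq) in
/-- The Euler product `P(s) = ∏_P (1 - 1/(|P|^s (|P|+1)))`. -/
def eulerP (s : ℂ) : ℂ :=
  ∏' P : {P : Polynomial Fq // P.Monic ∧ Irreducible P},
    (1 - (((Fintype.card Fq : ℂ) ^ (P.1.natDegree : ℂ)) ^ s *
          ((Fintype.card Fq : ℂ) ^ (P.1.natDegree : ℂ) + 1))⁻¹)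

variable (Fq) in
/-- `(1/log q)·(P'/P)(1) = ∑_P deg P / (|P|(|P|+1) - 1)`. -/
def eulerPlogDeriv : ℂ :=
  ∑' P : {P : Polynomial Fq // P.Monic ∧ Irreducible P},
    (P.1.natDegree : ℂ) /
      ((Fintype.card Fq : ℂ) ^ (P.1.natDegree : ℂ) *
        ((Fintype.card Fq : ℂ) ^ (P.1.natDegree : ℂ) + 1) - 1)

open scoped Classical in
/-- `∏_{P | D} 1/(|P|+1)` over the distinct monic irreducible factors of `D`, real. -/
def facProdR (D : Polynomial Fq) : ℝ :=
  ∏ P ∈ (normalizedFactors D).toFinset, ((Fintype.card Fq : ℝ) ^ P.natDegree + 1)⁻¹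

open scoped Classical in
/-- `∏_{P | D} 1/(|P|+1)` over the distinct monic irreducible factors of `D`, complex. -/
def facProdC (D : Polynomial Fq) : ℂ :=
  ∏ P ∈ (normalizedFactors D).toFinset, ((Fintype.card Fq : ℂ) ^ P.natDegree + 1)⁻¹

open scoped Classical in
/-- The sum `Σ_{D monic, deg D ≤ m} μ(D)/|D|^{w} ∏_{P|D} 1/(|P|+1)` with complex exponent. -/
def moebSum (m : ℕ) (w : ℂ) : ℂ :=
  ∑' D : {D : Polynomial Fq // D.Monic ∧ D.natDegree ≤ m},
    (muA D.1 : ℂ) / ((Fintype.card Fq : ℂ) ^ (D.1.natDegree : ℂ)) ^ w * facProdC D.1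

end FFArith


namespace FFArith

section Aux

variable {F : Type} [Field F] [Fintype F]

lemma finite_degLT (n : ℕ) : {g : F[X] | g.degree < n}.Finite := by
  have e : {g : F[X] // g.degree < n} ≃ (Fin n → F) :=
    (Equiv.subtypeEquivRight (fun g => (mem_degreeLT (n := n) (f := g)).symm)).trans
      (degreeLTEquiv F n).toEquiv
  have : Finite {g : F[X] // g.degree < n} := Finite.of_equiv _ e.symm
  exact Set.finite_coe_iff.1 this

lemma finite_monic (n : ℕ) : {g : F[X] | g.Monic ∧ g.natDegree = n}.Finite := by
  have e : {g : F[X] // g.Monic ∧ g.natDegree = n} ≃ (Fin n → F) :=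
    (monicEquivDegreeLT n).trans (degreeLTEquiv F n).toEquiv
  have : Finite {g : F[X] // g.Monic ∧ g.natDegree = n} := Finite.of_equiv _ e.symm
  exact Set.finite_coe_iff.1 this

variable (F) in
/-- Residues: polynomials of degree `< n`. -/
def Rs (n : ℕ) : Finset F[X] := (finite_degLT (F := F) n).toFinset

variable (F) in
/-- Monic polynomials of degree `n`. -/
def Ms (n : ℕ) : Finset F[X] := (finite_monic (F := F) n).toFinset

lemma mem_Rs {n : ℕ} {g : F[X]} : g ∈ Rs F n ↔ g.degree < n := by simp [Rs]

lemma mem_Ms {n : ℕ} {g : F[X]} : g ∈ Ms F n ↔ g.Monic ∧ g.natDegree = n := by simp [Ms]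

lemma card_Rs (n : ℕ) : (Rs F n).card = Fintype.card F ^ n := by
  have e : {g : F[X] // g ∈ Rs F n} ≃ (Fin n → F) :=
    (Equiv.subtypeEquivRight (fun g => mem_Rs.trans (mem_degreeLT (n := n) (f := g)).symm)).trans
      (degreeLTEquiv F n).toEquiv
  rw [← Nat.card_eq_finsetCard, Nat.card_congr e]; simp

lemma card_Ms (n : ℕ) : (Ms F n).card = Fintype.card F ^ n := by
  have e : {g : F[X] // g ∈ Ms F n} ≃ (Fin n → F) :=
    (Equiv.subtypeEquivRight (fun g => mem_Ms)).trans
    ((monicEquivDegreeLT n).trans (degreeLTEquiv F n).toEquiv)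
  rw [← Nat.card_eq_finsetCard, Nat.card_congr e]; simp

lemma isUnit_mk_iff (f g : F[X]) :
    IsUnit (Ideal.Quotient.mk (Ideal.span {f}) g) ↔ IsCoprime g f := by
  constructor
  · intro h
    obtain ⟨b, hb⟩ := h.exists_right_inv
    obtain ⟨b, rfl⟩ := Ideal.Quotient.mk_surjective b
    rw [← map_mul, ← map_one (Ideal.Quotient.mk _), Ideal.Quotient.eq,
      Ideal.mem_span_singleton] at hb
    obtain ⟨c, hc⟩ := hb
    exact ⟨b, -c, by linear_combination hc⟩
  · rintro ⟨a, b, h⟩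
    refine IsUnit.of_mul_eq_one (Ideal.Quotient.mk _ a) ?_
    rw [← map_mul, ← map_one (Ideal.Quotient.mk _), Ideal.Quotient.eq,
      Ideal.mem_span_singleton]
    exact ⟨-b, by linear_combination h⟩

open scoped Classical in
lemma Phi_eq {f : F[X]} (hf : f.Monic) :
    PhiA f = ((Rs F f.natDegree).filter (fun g => IsCoprime g f)).card := by
  have hdeg : f.degree = (f.natDegree : WithBot ℕ) := degree_eq_natDegree hf.ne_zero
  rw [PhiA, ← Nat.card_eq_finsetCard]
  symm
  refine Nat.card_eq_of_bijective (fun g => ((isUnit_mk_iff f g.1).2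
    (Finset.mem_filter.1 g.2).2).unit) ⟨?_, ?_⟩
  · rintro ⟨g, hg⟩ ⟨g', hg'⟩ h
    have h1 := congrArg Units.val h
    simp only [IsUnit.unit_spec] at h1
    rw [Ideal.Quotient.eq, Ideal.mem_span_singleton] at h1
    rw [Finset.mem_filter, mem_Rs] at hg hg'
    have := eq_zero_of_dvd_of_degree_lt h1 (by
      rw [hdeg]
      exact lt_of_le_of_lt (degree_sub_le _ _) (max_lt hg.1 hg'.1))
    exact Subtype.ext (sub_eq_zero.1 this)
  · intro u
    obtain ⟨g, hg⟩ := Ideal.Quotient.mk_surjective u.1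
    have hm : Ideal.Quotient.mk (Ideal.span {f}) (g %ₘ f) = u.1 := by
      rw [← hg, Ideal.Quotient.eq, Ideal.mem_span_singleton]
      exact ⟨-(g /ₘ f), by linear_combination modByMonic_add_div g f⟩
    refine ⟨⟨g %ₘ f, ?_⟩, ?_⟩
    · rw [Finset.mem_filter, mem_Rs, ← hdeg]
      refine ⟨degree_modByMonic_lt _ hf, ?_⟩
      rw [← isUnit_mk_iff, hm]
      exact u.isUnit
    · exact Units.ext hm

open scoped Classical in
lemma count_coprime {g : F[X]} (hg : g.Monic) (d : ℕ) :
    ((Rs F (g.natDegree + d)).filter (fun h => IsCoprime h g)).card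
      = Fintype.card F ^ d * PhiA g := by
  have hdeg : g.degree = (g.natDegree : WithBot ℕ) := degree_eq_natDegree hg.ne_zero
  rw [Phi_eq hg, mul_comm, ← card_Rs, ← Finset.card_product]
  symm
  refine Finset.card_bij (fun p _ => p.1 + g * p.2) ?_ ?_ ?_
  · rintro ⟨h, t⟩ hp
    simp only [Finset.mem_product, Finset.mem_filter, mem_Rs] at hp ⊢
    refine ⟨?_, IsCoprime.add_mul_left_left_iff.2 hp.1.2⟩
    refine lt_of_le_of_lt (degree_add_le _ _) (max_lt ?_ ?_)
    · exact lt_of_lt_of_le hp.1.1 (by exact_mod_cast Nat.le_add_right _ _)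
    · rw [degree_mul, hdeg]
      by_cases ht : t = 0
      · subst ht; simp
      · rw [degree_eq_natDegree ht] at hp ⊢
        have := hp.2
        norm_cast at this ⊢
        omega
  · rintro ⟨h, t⟩ hp ⟨h', t'⟩ hp' heq
    simp only [Finset.mem_product, Finset.mem_filter, mem_Rs] at hp hp' heq
    have h1 := div_modByMonic_unique t h hg ⟨rfl, by rw [hdeg]; exact hp.1.1⟩
    have h2 := div_modByMonic_unique t' h' hg ⟨rfl, by rw [hdeg]; exact hp'.1.1⟩
    rw [heq] at h1
    rw [Prod.mk.injEq]
    exact ⟨h1.2.symm.trans h2.2, h1.1.symm.trans h2.1⟩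
  · intro b hb
    simp only [Finset.mem_filter, mem_Rs] at hb
    have hb' := modByMonic_add_div b g
    refine ⟨(b %ₘ g, b /ₘ g), ?_, hb'⟩
    simp only [Finset.mem_product, Finset.mem_filter, mem_Rs]
    refine ⟨⟨by rw [← hdeg]; exact degree_modByMonic_lt _ hg, ?_⟩, ?_⟩
    · rw [← hb'] at hb
      exact IsCoprime.add_mul_left_left_iff.1 hb.2
    · by_cases ht : b /ₘ g = 0
      · rw [ht]; simp
      · have hle : g.degree ≤ b.degree := by
          by_contra hlt
          exact ht ((divByMonic_eq_zero_iff hg).2 (not_le.1 hlt))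
        have h3 := degree_add_divByMonic hg hle
        have h4 := hb.1
        rw [← h3, hdeg, degree_eq_natDegree ht] at h4
        rw [degree_eq_natDegree ht]
        norm_cast at h4 ⊢
        omega

lemma Phi_mul_dvd {P g : F[X]} (hP : P.Monic) (hg : g.Monic) (h : P ∣ g) :
    PhiA (P * g) = Fintype.card F ^ P.natDegree * PhiA g := by
  classical
  rw [Phi_eq (hP.mul hg), hP.natDegree_mul hg, add_comm, ← count_coprime hg]
  congr 1
  apply Finset.filter_congr
  intro x _
  constructor
  · exact fun hx => hx.of_mul_right_right
  · exact fun hx => IsCoprime.mul_right (hx.of_isCoprime_of_dvd_right h) hx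

lemma Phi_mul_not_dvd {P g : F[X]} (hP : P.Monic) (hPi : Irreducible P) (hg : g.Monic)
    (h : ¬ P ∣ g) :
    PhiA (P * g) + PhiA g = Fintype.card F ^ P.natDegree * PhiA g := by
  classical
  have hco : IsCoprime P g := hPi.coprime_iff_not_dvd.2 h
  have hPdeg : P.degree = (P.natDegree : WithBot ℕ) := degree_eq_natDegree hP.ne_zero
  rw [Phi_eq (hP.mul hg), hP.natDegree_mul hg, add_comm P.natDegree, ← count_coprime hg,
    ← Finset.card_filter_add_card_filter_not (s := (Rs F (g.natDegree + P.natDegree)).filter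
      (fun h => IsCoprime h g)) (fun h => IsCoprime h P)]
  congr 1
  · congr 1
    rw [Finset.filter_filter]
    apply Finset.filter_congr
    intro x _
    rw [IsCoprime.mul_right_iff, and_comm]
  · rw [Phi_eq hg]
    refine Finset.card_bij (fun t _ => P * t) ?_ ?_ ?_
    · intro t ht
      simp only [Finset.mem_filter, mem_Rs] at ht ⊢
      refine ⟨⟨?_, IsCoprime.mul_left hco ht.2⟩, ?_⟩
      · rw [degree_mul, hPdeg]
        by_cases h0 : t = 0
        · subst h0; simp
        · rw [degree_eq_natDegree h0] at ht ⊢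
          have := ht.1
          norm_cast at this ⊢
          omega
      · rw [isCoprime_comm, hPi.coprime_iff_not_dvd, not_not]
        exact dvd_mul_right _ _
    · intro a _ b _ hab
      exact mul_left_cancel₀ hP.ne_zero hab
    · intro b hb
      simp only [Finset.mem_filter, mem_Rs] at hb
      have hd := hb.2
      rw [isCoprime_comm, hPi.coprime_iff_not_dvd, not_not] at hd
      obtain ⟨t, rfl⟩ := hd
      refine ⟨t, ?_, rfl⟩
      simp only [Finset.mem_filter, mem_Rs]
      refine ⟨?_, hb.1.2.of_mul_left_right⟩
      have h1 := hb.1.1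
      by_cases h0 : t = 0
      · subst h0; simp
      · rw [degree_mul, hPdeg, degree_eq_natDegree h0] at h1
        rw [degree_eq_natDegree h0]
        norm_cast at h1 ⊢
        omega

lemma exists_monic_gcd {f g : F[X]} (hf : f.Monic) :
    ∃ h f' g' : F[X], h.Monic ∧ f = h * f' ∧ g = h * g' ∧ IsCoprime g' f' := by
  classical
  set k := EuclideanDomain.gcd f g with hk
  have hkf : k ∣ f := EuclideanDomain.gcd_dvd_left f g
  have hkg : k ∣ g := EuclideanDomain.gcd_dvd_right f g
  have hk0 : k ≠ 0 := fun h0 => hf.ne_zero (by rwa [h0, zero_dvd_iff] at hkf)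
  have hbez := EuclideanDomain.gcd_eq_gcd_ab f g
  rw [← hk] at hbez
  have hm : (normalize k).Monic := monic_normalize hk0
  obtain ⟨f', hf'⟩ := normalize_dvd_iff.2 hkf
  obtain ⟨g', hg'⟩ := normalize_dvd_iff.2 hkg
  obtain ⟨c, hc⟩ := normalize_dvd_iff.2 (dvd_refl k)
  obtain ⟨e, he⟩ := dvd_normalize_iff.2 (dvd_refl k)
  refine ⟨normalize k, f', g', hm, hf', hg', ?_⟩
  generalize EuclideanDomain.gcdA f g = a at hbez
  generalize EuclideanDomain.gcdB f g = b at hbez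
  generalize normalize k = m at *
  refine ⟨b * e, a * e, ?_⟩
  apply mul_left_cancel₀ hm.ne_zero
  linear_combination -he - e * hbez - a * e * hf' - b * e * hg'

variable (F) in
/-- Sum of `Φ` over monic `f` of degree `n` divisible by no element of `s`. -/
def S (s : Finset F[X]) (n : ℕ) : ℕ := by
  classical
  exact ∑ f ∈ (Ms F n).filter (fun f => ∀ P ∈ s, ¬ P ∣ f), PhiA f

lemma S_empty (n : ℕ) : S F ∅ n = ∑ f ∈ Ms F n, PhiA f := by
  simp [S]

lemma sum_base (n : ℕ) :
    Fintype.card F ^ n * Fintype.card F ^ n =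
      ∑ p ∈ Finset.HasAntidiagonal.antidiagonal n, Fintype.card F ^ p.1 * S F ∅ p.2 := by
  classical
  have h1 : ∀ p : ℕ × ℕ, Fintype.card F ^ p.1 * S F ∅ p.2 =
      ((Ms F p.1) ×ˢ ((Ms F p.2).sigma
        (fun f => (Rs F p.2).filter (fun g => IsCoprime g f)))).card := by
    intro p
    rw [Finset.card_product, card_Ms, Finset.card_sigma, S_empty]
    congr 1
    refine Finset.sum_congr rfl fun f hf => ?_
    rw [mem_Ms] at hf
    rw [Phi_eq hf.1, hf.2]
  simp_rw [h1]
  rw [← Finset.card_sigma]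
  have h2 : Fintype.card F ^ n * Fintype.card F ^ n = (Ms F n ×ˢ Rs F n).card := by
    rw [Finset.card_product, card_Ms, card_Rs]
  rw [h2]
  symm
  refine Finset.card_bij (fun x _ => (x.2.1 * x.2.2.1, x.2.1 * x.2.2.2)) ?_ ?_ ?_
  · rintro ⟨⟨i, j⟩, h, f, g⟩ hx
    simp only [Finset.mem_sigma, Finset.mem_product, Finset.mem_filter, mem_Rs, mem_Ms,
      Finset.HasAntidiagonal.mem_antidiagonal] at hx ⊢
    obtain ⟨hij, ⟨hh, hhd⟩, ⟨hf, hfd⟩, hg, hc⟩ := hx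
    refine ⟨⟨hh.mul hf, by rw [hh.natDegree_mul hf]; omega⟩, ?_⟩
    rw [degree_mul, degree_eq_natDegree hh.ne_zero]
    by_cases h0 : g = 0
    · subst h0; simp
    · rw [degree_eq_natDegree h0] at hg ⊢
      norm_cast at hg ⊢
      omega
  · rintro ⟨⟨i, j⟩, h, f, g⟩ hx ⟨⟨i', j'⟩, h', f', g'⟩ hx' heq
    simp only [Finset.mem_sigma, Finset.mem_product, Finset.mem_filter, mem_Rs, mem_Ms,
      Finset.HasAntidiagonal.mem_antidiagonal, Prod.mk.injEq] at hx hx' heq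
    obtain ⟨hij, ⟨hh, hhd⟩, ⟨hf, hfd⟩, hg, a, b, hc⟩ := hx
    obtain ⟨hij', ⟨hh', hhd'⟩, ⟨hf', hfd'⟩, hg', a', b', hc'⟩ := hx'
    obtain ⟨e1, e2⟩ := heq
    have hhh : h = h' := by
      refine eq_of_monic_of_associated hh hh' (associated_of_dvd_dvd ?_ ?_)
      · exact ⟨a' * g + b' * f, by linear_combination -h' * hc' - a' * e2 - b' * e1⟩
      · exact ⟨a * g' + b * f', by linear_combination -h * hc + a * e2 + b * e1⟩
    subst hhh
    have e1 := mul_left_cancel₀ hh.ne_zero e1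
    have e2 := mul_left_cancel₀ hh.ne_zero e2
    subst e1 e2 hhd hhd' hfd hfd'
    rfl
  · rintro ⟨f, g⟩ hfg
    simp only [Finset.mem_product, mem_Rs, mem_Ms] at hfg
    obtain ⟨⟨hf, hfd⟩, hg⟩ := hfg
    obtain ⟨h, f', g', hh, rfl, rfl, hc⟩ := exists_monic_gcd (g := g) hf
    have hf' : f'.Monic := hh.of_mul_monic_left hf
    rw [hh.natDegree_mul hf'] at hfd
    refine ⟨⟨(h.natDegree, f'.natDegree), h, f', g'⟩, ?_, rfl⟩
    simp only [Finset.mem_sigma, Finset.mem_product, Finset.mem_filter, mem_Rs, mem_Ms,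
      Finset.HasAntidiagonal.mem_antidiagonal]
    refine ⟨hfd, ⟨hh, trivial⟩, ⟨hf', trivial⟩, ?_, hc⟩
    by_cases h0 : g' = 0
    · subst h0; simp
    · rw [degree_mul, degree_eq_natDegree hh.ne_zero, degree_eq_natDegree h0] at hg
      rw [degree_eq_natDegree h0]
      norm_cast at hg ⊢
      omega

lemma S_base (n : ℕ) : S F ∅ (n + 1) + Fintype.card F ^ (2 * n + 1) =
    Fintype.card F ^ (2 * n + 2) := by
  have h1 := sum_base (F := F) (n + 1)
  have h0 := sum_base (F := F) n
  rw [Finset.Nat.sum_antidiagonal_succ] at h1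
  simp only [pow_zero, one_mul, pow_succ] at h1
  have h2 : ∑ p ∈ Finset.HasAntidiagonal.antidiagonal n, Fintype.card F ^ p.1 * Fintype.card F * S F ∅ p.2
      = Fintype.card F * (Fintype.card F ^ n * Fintype.card F ^ n) := by
    rw [h0, Finset.mul_sum]
    exact Finset.sum_congr rfl fun p _ => by ring
  rw [h2] at h1
  linarith [h1, show Fintype.card F ^ (2 * n + 1) =
    Fintype.card F * (Fintype.card F ^ n * Fintype.card F ^ n) by ring,
    show Fintype.card F ^ (2 * n + 2) =
    Fintype.card F ^ n * Fintype.card F * (Fintype.card F ^ n * Fintype.card F) by ring]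

open scoped Classical in
lemma S_small {s : Finset F[X]} {P : F[X]} {n : ℕ} (hn : n < P.natDegree) :
    S F (insert P s) n = S F s n := by
  classical
  unfold S
  refine Finset.sum_congr (Finset.filter_congr fun f hf => ?_) fun _ _ => rfl
  rw [mem_Ms] at hf
  have : ¬ P ∣ f := fun h => by
    have := natDegree_le_of_dvd h hf.1.ne_zero
    omega
  simp [this]

open scoped Classical in
lemma S_rec {s : Finset F[X]} {P : F[X]} (hP : P.Monic) (hPi : Irreducible P)
    (hs : ∀ Q ∈ s, Q.Monic ∧ Irreducible Q) (hPs : P ∉ s) (n : ℕ) :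
    S F s (n + P.natDegree) + S F (insert P s) n =
      S F (insert P s) (n + P.natDegree) + Fintype.card F ^ P.natDegree * S F s n := by
  classical
  have hsplit : ∀ m, (Ms F m).filter (fun f => ∀ Q ∈ insert P s, ¬ Q ∣ f) =
      ((Ms F m).filter (fun f => ∀ Q ∈ s, ¬ Q ∣ f)).filter (fun f => ¬ P ∣ f) := by
    intro m
    rw [Finset.filter_filter]
    refine Finset.filter_congr fun f _ => ?_
    simp [and_comm]
  have hd : ∑ f ∈ ((Ms F (n + P.natDegree)).filter
      (fun f => ∀ Q ∈ s, ¬ Q ∣ f)).filter (fun f => P ∣ f), PhiA f =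
      ∑ g ∈ (Ms F n).filter (fun f => ∀ Q ∈ s, ¬ Q ∣ f), PhiA (P * g) := by
    symm
    refine Finset.sum_bij (fun g _ => P * g) ?_ ?_ ?_ ?_
    · intro g hg
      simp only [Finset.mem_filter, mem_Ms] at hg ⊢
      refine ⟨⟨⟨hP.mul hg.1.1, by rw [hP.natDegree_mul hg.1.1]; omega⟩, ?_⟩, dvd_mul_right _ _⟩
      intro Q hQ hdvd
      rcases (hs Q hQ).2.prime.dvd_or_dvd hdvd with h | h
      · have := eq_of_monic_of_associated (hs Q hQ).1 hP ((hs Q hQ).2.associated_of_dvd hPi h)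
        exact hPs (this ▸ hQ)
      · exact hg.2 Q hQ h
    · intro a _ b _ hab
      exact mul_left_cancel₀ hP.ne_zero hab
    · intro b hb
      simp only [Finset.mem_filter, mem_Ms] at hb
      obtain ⟨⟨⟨hbm, hbd⟩, hbs⟩, g, rfl⟩ := hb
      have hg : g.Monic := hP.of_mul_monic_left hbm
      rw [hP.natDegree_mul hg] at hbd
      refine ⟨g, ?_, rfl⟩
      simp only [Finset.mem_filter, mem_Ms]
      exact ⟨⟨hg, by omega⟩, fun Q hQ hdvd => hbs Q hQ (dvd_mul_of_dvd_right hdvd _)⟩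
    · intros; rfl
  unfold S
  rw [hsplit, hsplit, ← Finset.sum_filter_add_sum_filter_not
    ((Ms F (n + P.natDegree)).filter (fun f => ∀ Q ∈ s, ¬ Q ∣ f)) (fun f => P ∣ f), hd]
  have key : ∑ g ∈ (Ms F n).filter (fun f => ∀ Q ∈ s, ¬ Q ∣ f), PhiA (P * g) +
      ∑ f ∈ ((Ms F n).filter (fun f => ∀ Q ∈ s, ¬ Q ∣ f)).filter (fun f => ¬ P ∣ f), PhiA f =
      Fintype.card F ^ P.natDegree * ∑ g ∈ (Ms F n).filter (fun f => ∀ Q ∈ s, ¬ Q ∣ f), PhiA g := by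
    rw [Finset.mul_sum, Finset.sum_filter (fun f => ¬ P ∣ f), ← Finset.sum_add_distrib]
    refine Finset.sum_congr rfl fun g hg => ?_
    simp only [Finset.mem_filter, mem_Ms] at hg
    by_cases h : P ∣ g
    · simp [h, Phi_mul_dvd hP hg.1.1 h]
    · simp [h, Phi_mul_not_dvd hP hPi hg.1.1 h]
  linarith


lemma analytic_step (a b : ℕ → ℝ) (Q c C : ℝ) (d : ℕ) (hQ : 2 ≤ Q) (hd : 1 ≤ d) (hC : 0 < C)
    (ha : ∀ n, |a n - c * Q ^ (2 * n)| ≤ C * Q ^ n)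
    (hsmall : ∀ n, n < d → b n = a n)
    (hrec : ∀ n, a (n + d) + b n = b (n + d) + Q ^ d * a n) :
    ∃ C' : ℝ, 0 < C' ∧ ∀ n, |b n - c * (1 + (Q ^ d)⁻¹)⁻¹ * Q ^ (2 * n)| ≤ C' * Q ^ n := by
  have hQ1 : (1 : ℝ) ≤ Q := by linarith
  have hD : 2 ≤ Q ^ d := hQ.trans (le_self_pow₀ hQ1 (by omega))
  set c' := c * (1 + (Q ^ d)⁻¹)⁻¹ with hc'
  have hcc : c' * (Q ^ d + 1) = Q ^ d * c := by
    rw [hc']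
    have : Q ^ d ≠ 0 := by positivity
    have : Q ^ d + 1 ≠ 0 := by positivity
    field_simp
  clear_value c'
  refine ⟨4 * C + |c - c'| * Q ^ d, by positivity, ?_⟩
  set C' := 4 * C + |c - c'| * Q ^ d with hC'
  have hC'4 : 4 * C ≤ C' := by
    have : 0 ≤ |c - c'| * Q ^ d := by positivity
    linarith
  intro n
  induction n using Nat.strong_induction_on with
  | _ n ih =>
    rcases lt_or_ge n d with hn | hn
    · rw [hsmall n hn]
      have e : a n - c' * Q ^ (2 * n) = (a n - c * Q ^ (2 * n)) + (c - c') * Q ^ (2 * n) := by ring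
      rw [e]
      refine (abs_add_le _ _).trans ?_
      have h1 : |(c - c') * Q ^ (2 * n)| ≤ |c - c'| * Q ^ d * Q ^ n := by
        rw [abs_mul, abs_of_nonneg (by positivity : 0 ≤ Q ^ (2 * n)), mul_assoc, ← pow_add]
        gcongr
        omega
      have h2 : 0 ≤ C * Q ^ n := by positivity
      have h3 := ha n
      rw [hC']
      linarith
    · obtain ⟨m, rfl⟩ := Nat.exists_eq_add_of_le' hn
      have h1 := ih m (by omega)
      have h2 := ha (m + d)
      have h3 := ha m
      have e : b (m + d) - c' * Q ^ (2 * (m + d)) =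
          (b m - c' * Q ^ (2 * m)) + (a (m + d) - c * Q ^ (2 * (m + d)))
            - Q ^ d * (a m - c * Q ^ (2 * m)) := by
        have hp : Q ^ (2 * (m + d)) = Q ^ (2 * m) * (Q ^ d * Q ^ d) := by ring
        rw [hp]
        linear_combination -hrec m - (Q ^ d - 1) * Q ^ (2 * m) * hcc
      rw [e]
      refine (abs_sub _ _).trans ?_
      have h4 := abs_add_le (b m - c' * Q ^ (2 * m)) (a (m + d) - c * Q ^ (2 * (m + d)))
      rw [abs_mul, abs_of_nonneg (by positivity : 0 ≤ Q ^ d)]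
      have h5 : Q ^ d * |a m - c * Q ^ (2 * m)| ≤ Q ^ d * (C * Q ^ m) := by gcongr
      rw [pow_add] at h2 ⊢
      have h6 : 0 ≤ Q ^ m * ((C' - 4 * C) * (Q ^ d - 1) + 2 * C * (Q ^ d - 2)) := by
        have : 0 ≤ C' - 4 * C := by linarith
        have : 0 ≤ Q ^ d - 1 := by linarith
        have : 0 ≤ Q ^ d - 2 := by linarith
        positivity
      nlinarith

lemma S_asymp (s : Finset F[X]) (hs : ∀ Q ∈ s, Q.Monic ∧ Irreducible Q) :
    ∃ C : ℝ, 0 < C ∧ ∀ n, |(S F s n : ℝ) - (1 - (Fintype.card F : ℝ)⁻¹) *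
      (∏ P ∈ s, (1 + ((Fintype.card F : ℝ) ^ P.natDegree)⁻¹)⁻¹) *
      (Fintype.card F : ℝ) ^ (2 * n)| ≤ C * (Fintype.card F : ℝ) ^ n := by
  classical
  have hq : (2 : ℝ) ≤ Fintype.card F := by exact_mod_cast Fintype.one_lt_card (α := F)
  induction s using Finset.induction_on with
  | empty =>
    refine ⟨|(S F ∅ 0 : ℝ) - (1 - (Fintype.card F : ℝ)⁻¹)| + 1, by positivity, ?_⟩
    intro n
    cases n with
    | zero => simp
    | succ n =>
      have h := S_base (F := F) n
      have h' : (S F ∅ (n + 1) : ℝ) + (Fintype.card F : ℝ) ^ (2 * n + 1) =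
        (Fintype.card F : ℝ) ^ (2 * n + 2) := by exact_mod_cast h
      have : (S F ∅ (n + 1) : ℝ) - (1 - (Fintype.card F : ℝ)⁻¹) *
        (∏ P ∈ (∅ : Finset F[X]), (1 + ((Fintype.card F : ℝ) ^ P.natDegree)⁻¹)⁻¹) *
        (Fintype.card F : ℝ) ^ (2 * (n + 1)) = 0 := by
        rw [eq_sub_of_add_eq h', Finset.prod_empty]
        have : (Fintype.card F : ℝ) ≠ 0 := by positivity
        field_simp
        ring
      rw [this, abs_zero]
      positivity
  | insert P s hP ih =>
    obtain ⟨C, hC, h⟩ := ih fun Q hQ => hs Q (Finset.mem_insert_of_mem hQ)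
    obtain ⟨hPm, hPi⟩ := hs P (Finset.mem_insert_self _ _)
    obtain ⟨C', hC', h'⟩ := analytic_step (fun n => (S F s n : ℝ))
      (fun n => (S F (insert P s) n : ℝ)) (Fintype.card F) _ C P.natDegree hq hPi.natDegree_pos hC h
      (fun n hn => by simp only [S_small hn])
      (fun n => by
        have hr := S_rec hPm hPi (fun Q hQ => hs Q (Finset.mem_insert_of_mem hQ)) hP n
        exact_mod_cast hr)
    refine ⟨C', hC', fun n => ?_⟩
    rw [Finset.prod_insert hP, mul_comm (1 + _)⁻¹, ← mul_assoc]
    exact h' n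

open scoped Classical in
lemma monic_of_mem {L P : F[X]} (hP : P ∈ normalizedFactors L) : P.Monic ∧ Irreducible P := by
  have hi := irreducible_of_normalized_factor P hP
  refine ⟨?_, hi⟩
  rw [← normalize_normalized_factor P hP]
  exact monic_normalize hi.ne_zero

open scoped Classical in
lemma coprime_iff {L f : F[X]} (hL : L.Monic) :
    IsCoprime f L ↔ ∀ P ∈ normalizedFactors L, ¬ P ∣ f := by
  constructor
  · intro h P hP hd
    exact (monic_of_mem hP).2.not_isUnit (h.isUnit_of_dvd' hd (dvd_of_mem_normalizedFactors hP))
  · intro h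
    refine isCoprime_of_prime_dvd (fun h0 => hL.ne_zero h0.2) fun z hz hzf hzL => ?_
    obtain ⟨P, hP, hPz⟩ := exists_mem_normalizedFactors_of_dvd hL.ne_zero hz.irreducible hzL
    exact h P hP (hPz.symm.dvd.trans hzf)

open scoped Classical in
lemma tsum_eq_S (L : F[X]) (hL : L.Monic) (n : ℕ) :
    (∑' f : {f : F[X] // f.Monic ∧ f.natDegree = n ∧ IsCoprime f L}, (PhiA f.1 : ℝ)) =
      S F (normalizedFactors L).toFinset n := by
  unfold S
  push_cast
  rw [← Finset.tsum_subtype]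
  refine (Equiv.tsum_eq (Equiv.subtypeEquivRight fun f => ?_)
    (fun f : {f // f ∈ (Ms F n).filter (fun f => ∀ P ∈ (normalizedFactors L).toFinset, ¬ P ∣ f)}
      => (PhiA f.1 : ℝ)))
  simp only [Finset.mem_filter, mem_Ms, coprime_iff hL, Multiset.mem_toFinset, and_assoc]

end Aux

open scoped Classical in
theorem statement12 {Fq : Type} [Field Fq] [Fintype Fq] (L : Polynomial Fq)
    (hL : L.Monic) (ε : ℝ) (hε : 0 < ε) :
    ∃ C : ℝ, 0 < C ∧ ∀ n : ℕ, 1 ≤ n →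
      |(∑' f : {f : Polynomial Fq // f.Monic ∧ f.natDegree = n ∧ IsCoprime f L},
          (PhiA f.1 : ℝ)) -
        (zetaR (Fintype.card Fq) 2)⁻¹ * (Fintype.card Fq : ℝ) ^ (2 * n) *
          ∏ P ∈ (normalizedFactors L).toFinset,
            (1 + ((Fintype.card Fq : ℝ) ^ P.natDegree)⁻¹)⁻¹| ≤
        C * (Fintype.card Fq : ℝ) ^ ((1 + ε) * n) := by
  obtain ⟨C, hC, h⟩ := S_asymp (normalizedFactors L).toFinset
    (fun Q hQ => monic_of_mem (Multiset.mem_toFinset.1 hQ))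
  have hq : (2 : ℝ) ≤ Fintype.card Fq := by exact_mod_cast Fintype.one_lt_card (α := Fq)
  refine ⟨C, hC, fun n _ => ?_⟩
  rw [tsum_eq_S L hL n]
  have hz : (zetaR (Fintype.card Fq) 2)⁻¹ = 1 - (Fintype.card Fq : ℝ)⁻¹ := by
    rw [zetaR, inv_inv, show (1 : ℝ) - 2 = -1 by norm_num, Real.rpow_neg_one]
  rw [hz, mul_right_comm]
  refine (h n).trans ?_
  gcongr
  rw [← Real.rpow_natCast]
  apply Real.rpow_le_rpow_of_exponent_le (by linarith)
  have : (0 : ℝ) ≤ ε * n := by positivity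
  linarith

end FFArith
end
end
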